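/- arXiv:1308.3730 — 4 statements merged into one kernel-verified Lean document; each statement's English description precedes it below -/
import Mathlib

section
/- Let δ be a J×J matrix of free polynomials and let Λ ∈ G_δ ∩ M_n^d, i.e., ‖δ(Λ)‖ < 1. Then the set C_Λ = { Σ_{i=1}^N u_i(Λ)* [I_{Jn} − δ(Λ)*δ(Λ)] u_i(Λ) : N ∈ ℕ, each u_i an L(ℂ,ℂ^J)-valued nc polynomial } is a closed subset of M_n(ℂ). -/
/- ## Basic framework for free (nc) function theory -/

noncomputable section

/-- A point of `M_n^d`: a `d`-tuple of `n × n` complex matrices. -/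
abbrev MatTuple (d n : ℕ) : Type := Fin d → Matrix (Fin n) (Fin n) ℂ

/-- Evaluation of a free polynomial `p ∈ P^d` at a `d`-tuple of `n × n` matrices:
the unital algebra homomorphism sending the `r`-th variable to `x r`. -/
noncomputable def evalPoly {d n : ℕ} (p : FreeAlgebra ℂ (Fin d)) (x : MatTuple d n) :
    Matrix (Fin n) (Fin n) ℂ :=
  FreeAlgebra.lift ℂ x p

/-- The operator norm (`ℓ² → ℓ²`) of a square complex matrix. -/
noncomputable def opNorm {ι : Type*} [Fintype ι] [DecidableEq ι] (A : Matrix ι ι ℂ) : ℝ :=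
  ‖Matrix.toEuclideanCLM (𝕜 := ℂ) A‖

/-- Evaluation of a `J × J` matrix `δ` of free polynomials at `x ∈ M_n^d`:
the `Jn × Jn` matrix whose `(i,j)` block is `δ i j` evaluated at `x`. -/
noncomputable def evalMat {d n J : ℕ} (δ : Matrix (Fin J) (Fin J) (FreeAlgebra ℂ (Fin d)))
    (x : MatTuple d n) : Matrix (Fin J × Fin n) (Fin J × Fin n) ℂ :=
  fun a b => evalPoly (δ a.1 b.1) x a.2 b.2

/-- The basic free open set `G_δ = {x : ‖δ(x)‖ < 1}`, at matrix size `n`. -/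
noncomputable def Gdel {d J : ℕ} (δ : Matrix (Fin J) (Fin J) (FreeAlgebra ℂ (Fin d))) (n : ℕ) :
    Set (MatTuple d n) :=
  {x | opNorm (evalMat δ x) < 1}

/-- Direct sum of two square complex matrices. -/
def mdsum {m n : ℕ} (A : Matrix (Fin m) (Fin m) ℂ) (B : Matrix (Fin n) (Fin n) ℂ) :
    Matrix (Fin (m + n)) (Fin (m + n)) ℂ :=
  Matrix.reindex finSumFinEquiv finSumFinEquiv (Matrix.fromBlocks A 0 0 B)

/-- Direct sum of two tuples of matrices (coordinatewise direct sum). -/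
def tdsum {d m n : ℕ} (x : MatTuple d m) (y : MatTuple d n) : MatTuple d (m + n) :=
  fun r => mdsum (x r) (y r)

/-- `φ` is an nc-function on the graded domain `D`: it preserves direct sums
and similarities. -/
structure IsNCFn {d : ℕ} (D : ∀ n, Set (MatTuple d n))
    (φ : ∀ n, MatTuple d n → Matrix (Fin n) (Fin n) ℂ) : Prop where
  map_dsum : ∀ {m n : ℕ} (x : MatTuple d m) (y : MatTuple d n),
      x ∈ D m → y ∈ D n → tdsum x y ∈ D (m + n) →
      φ (m + n) (tdsum x y) = mdsum (φ m x) (φ n y)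
  map_sim : ∀ {n : ℕ} (x : MatTuple d n) (s : Matrix (Fin n) (Fin n) ℂ),
      IsUnit s → x ∈ D n → (fun r => s⁻¹ * x r * s) ∈ D n →
      φ n (fun r => s⁻¹ * x r * s) = s⁻¹ * φ n x * s

/-- `φ` is bounded by `C` on the graded domain `D`. -/
def BddBy {d : ℕ} (D : ∀ n, Set (MatTuple d n))
    (φ : ∀ n, MatTuple d n → Matrix (Fin n) (Fin n) ℂ) (C : ℝ) : Prop :=
  ∀ n, ∀ x ∈ D n, opNorm (φ n x) ≤ C

/-- `D` is open in the free topology: every point has a basic free open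
neighbourhood contained in `D`. -/
def IsFreeOpen {d : ℕ} (D : ∀ n, Set (MatTuple d n)) : Prop :=
  ∀ n, ∀ x ∈ D n, ∃ (J : ℕ) (δ : Matrix (Fin J) (Fin J) (FreeAlgebra ℂ (Fin d))),
    x ∈ Gdel δ n ∧ ∀ m, Gdel δ m ⊆ D m

/-- `φ` is a free holomorphic function on the free open set `U`: every point of `U`
lies in a basic free open subset of `U` on which `φ` is a bounded nc-function. -/
def IsFreeHolo {d : ℕ} (U : ∀ n, Set (MatTuple d n))
    (φ : ∀ n, MatTuple d n → Matrix (Fin n) (Fin n) ℂ) : Prop :=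
  ∀ n, ∀ x ∈ U n, ∃ (J : ℕ) (δ : Matrix (Fin J) (Fin J) (FreeAlgebra ℂ (Fin d))),
    x ∈ Gdel δ n ∧ (∀ m, Gdel δ m ⊆ U m) ∧ IsNCFn (Gdel δ) φ ∧ ∃ C, BddBy (Gdel δ) φ C

/-- `φ` belongs to the closed unit ball of `H^∞(U)`. -/
def MemBallHinf {d : ℕ} (U : ∀ n, Set (MatTuple d n))
    (φ : ∀ n, MatTuple d n → Matrix (Fin n) (Fin n) ℂ) : Prop :=
  IsFreeHolo U φ ∧ BddBy U φ 1

/-- The variety `V_Λ` determined by `Λ` (at matrix size `m`): common zero set of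
the free polynomials annihilating `Λ`. -/
def VLam {d n : ℕ} (Λ : MatTuple d n) (m : ℕ) : Set (MatTuple d m) :=
  {x | ∀ p : FreeAlgebra ℂ (Fin d), evalPoly p Λ = 0 → evalPoly p x = 0}

end
open Matrix

noncomputable section

/-- Evaluation of an `L(ℂ,ℂ^J)`-valued nc polynomial (a `J × 1` column `u` of free
polynomials) at `x ∈ M_m^d`: the `Jm × m` matrix with blocks `uᵢ(x)`. -/
noncomputable def colEval {d m J : ℕ} (u : Fin J → FreeAlgebra ℂ (Fin d))
    (x : MatTuple d m) : Matrix (Fin J × Fin m) (Fin m) ℂ :=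
  fun a q => evalPoly (u a.1) x a.2 q

/-- Evaluation of a `JK × 1` column `u` of free polynomials at `x ∈ M_m^d`:
the `JKm × m` matrix with blocks the evaluations of its entries. -/
noncomputable def colEvalJK {d m J K : ℕ} (u : Fin J × Fin K → FreeAlgebra ℂ (Fin d))
    (x : MatTuple d m) : Matrix ((Fin J × Fin K) × Fin m) (Fin m) ℂ :=
  fun a q => evalPoly (u a.1) x a.2 q

/-- `δ(x) ⊗ I_{ℂ^K}`, under the canonical identification of
`ℂ^J ⊗ ℂ^n ⊗ ℂ^K` with `ℂ^{(J × K) × n}`. -/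
noncomputable def dTensorEval {d m J : ℕ} (δ : Matrix (Fin J) (Fin J) (FreeAlgebra ℂ (Fin d)))
    (K : ℕ) (x : MatTuple d m) :
    Matrix ((Fin J × Fin K) × Fin m) ((Fin J × Fin K) × Fin m) ℂ :=
  fun a b => if a.1.2 = b.1.2 then evalMat δ x (a.1.1, a.2) (b.1.1, b.2) else 0

/-- The ampliation `I_n ⊗ V` of a matrix `V`, under the canonical identification
of `ℂ^n ⊗ ℂ^ι` with `ℂ^{ι × n}`. -/
def ampliate {ι : Type*} (n : ℕ) (V : Matrix ι ι ℂ) : Matrix (ι × Fin n) (ι × Fin n) ℂ :=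
  fun a b => if a.2 = b.2 then V a.1 b.1 else 0

end
/-- A continuous map between real normed spaces, quadratically homogeneous and vanishing only
at the origin, has closed range when its domain is proper. -/
theorem isClosed_range_of_sq_homogeneous {E F : Type*} [NormedAddCommGroup E] [NormedSpace ℝ E]
    [ProperSpace E] [NormedAddCommGroup F] [NormedSpace ℝ F] [ProperSpace F] {f : E → F}
    (hf : Continuous f) (hom : ∀ (t : ℝ) (x : E), f (t • x) = t ^ 2 • f x)
    (h0 : ∀ x, f x = 0 → x = 0) : IsClosed (Set.range f) := by
  obtain ⟨c, hc, hcf⟩ : ∃ c : ℝ, 0 < c ∧ ∀ x ∈ Metric.sphere (0 : E) 1, c ≤ ‖f x‖ := by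
    refine (isCompact_sphere (0 : E) 1).exists_forall_le' hf.norm.continuousOn fun x hx => ?_
    refine norm_pos_iff.2 fun h => ?_
    simp [h0 x h] at hx
  have hle : ∀ x, c * ‖x‖ ^ 2 ≤ ‖f x‖ := by
    intro x
    by_cases hx : x = 0
    · simp [hx]
    have hx' : 0 < ‖x‖ := norm_pos_iff.2 hx
    have h := hcf (‖x‖⁻¹ • x) (by simp [norm_smul, hx'.ne'])
    rw [hom, norm_smul, norm_pow, norm_inv, norm_norm, inv_pow, inv_mul_eq_div,
      le_div_iff₀ (by positivity)] at h
    exact h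
  have htop : Filter.Tendsto (fun x => ‖f x‖) (Filter.cocompact E) Filter.atTop :=
    Filter.tendsto_atTop_mono hle (((Filter.tendsto_pow_atTop two_ne_zero).comp
      (tendsto_norm_cocompact_atTop (E := E))).const_mul_atTop hc)
  have hco : Filter.Tendsto f (Filter.cocompact E) (Filter.cocompact F) := by
    rw [← Metric.cobounded_eq_cocompact (α := F), ← tendsto_norm_atTop_iff_cobounded]
    exact htop
  exact (isProperMap_iff_tendsto_cocompact.2 ⟨hf, hco⟩).isClosedMap.isClosed_range

open scoped ComplexOrder in
/-- `1 - Dᴴ D` is positive definite when `D` is a strict contraction. -/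
theorem posDef_one_sub_conjTranspose_mul_self {ι : Type*} [Fintype ι] [DecidableEq ι]
    {D : Matrix ι ι ℂ} (hD : opNorm D < 1) : (1 - Dᴴ * D).PosDef := by
  refine Matrix.PosDef.of_dotProduct_mulVec_pos
    (Matrix.isHermitian_one.sub (Matrix.isHermitian_conjTranspose_mul_self D)) fun x hx => ?_
  have hsq : ∀ y : ι → ℂ, star y ⬝ᵥ y = ((‖WithLp.toLp 2 y‖ ^ 2 : ℝ) : ℂ) := by
    intro y
    rw [EuclideanSpace.norm_sq_eq]
    simp [dotProduct, Complex.conj_mul']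
  have hlt : ‖WithLp.toLp 2 (D *ᵥ x)‖ < ‖WithLp.toLp 2 x‖ := by
    have hpos : 0 < ‖WithLp.toLp 2 x‖ := norm_pos_iff.2 (by simpa using hx)
    have h := (Matrix.toEuclideanCLM (𝕜 := ℂ) D).le_opNorm (WithLp.toLp 2 x)
    rw [Matrix.toEuclideanCLM_toLp] at h
    exact h.trans_lt (mul_lt_of_lt_one_left hpos hD)
  have hexp : star x ⬝ᵥ ((1 - Dᴴ * D) *ᵥ x) = star x ⬝ᵥ x - star (D *ᵥ x) ⬝ᵥ (D *ᵥ x) := by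
    rw [Matrix.sub_mulVec, Matrix.one_mulVec, dotProduct_sub, ← Matrix.mulVec_mulVec,
      Matrix.star_mulVec, Matrix.dotProduct_mulVec, Matrix.dotProduct_mulVec]
  rw [hexp, hsq, hsq, ← Complex.ofReal_sub, Complex.zero_lt_real, sub_pos]
  exact pow_lt_pow_left₀ hlt (norm_nonneg _) two_ne_zero

/-- Evaluation of a column of free polynomials, as a linear map. -/
noncomputable def colEvalLin {d n : ℕ} (J : ℕ) (Λ : MatTuple d n) :
    (Fin J → FreeAlgebra ℂ (Fin d)) →ₗ[ℂ] Matrix (Fin J × Fin n) (Fin n) ℂ where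
  toFun u := colEval u Λ
  map_add' u v := by ext a q; simp [colEval, evalPoly]
  map_smul' c u := by ext a q; simp [colEval, evalPoly]

/-- The quadratic expression `∑ᵢ uᵢᴴ Q uᵢ` with `uᵢ = ∑ⱼ C i j • e j` depends only on `Cᴴ C`. -/
theorem sum_conjTranspose_mul_mul_eq {ι κ μ ν : Type*} [Fintype ι] [Fintype κ] [Fintype μ]
    (e : κ → Matrix μ ν ℂ) (Q : Matrix μ μ ℂ) (C : Matrix ι κ ℂ) :
    ∑ i, (∑ j, C i j • e j)ᴴ * Q * (∑ j, C i j • e j) =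
      ∑ j, ∑ l, (Cᴴ * C) j l • ((e j)ᴴ * Q * e l) := by
  have hterm : ∀ i, (∑ j, C i j • e j)ᴴ * Q * (∑ j, C i j • e j) =
      ∑ j, ∑ l, (star (C i j) * C i l) • ((e j)ᴴ * Q * e l) := by
    intro i
    simp only [Matrix.conjTranspose_sum, Matrix.conjTranspose_smul, Matrix.sum_mul,
      Matrix.mul_sum, Matrix.smul_mul, Matrix.mul_smul, mul_smul]
    rw [Finset.sum_comm]
    refine Finset.sum_congr rfl fun l _ => Finset.smul_sum.trans ?_
    exact Finset.sum_congr rfl fun j _ => smul_comm _ _ _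
  simp only [hterm, Matrix.mul_apply, Matrix.conjTranspose_apply, Finset.sum_smul]
  rw [Finset.sum_comm]
  exact Finset.sum_congr rfl fun j _ => Finset.sum_comm

open scoped ComplexOrder MatrixOrder Matrix.Norms.L2Operator in
/-- Every Gram matrix `Cᴴ C` is the Gram matrix of a square matrix. -/
theorem exists_conjTranspose_mul_self_eq_square {ι κ : Type*} [Fintype ι] [Fintype κ]
    [DecidableEq κ] (C : Matrix ι κ ℂ) : ∃ B : Matrix κ κ ℂ, Cᴴ * C = Bᴴ * B :=
  CStarAlgebra.nonneg_iff_eq_star_mul_self.1 (Matrix.posSemidef_conjTranspose_mul_self C).nonneg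

open scoped ComplexOrder in
/-- If `Q` is positive definite, a vanishing sum `∑ᵢ uᵢᴴ Q uᵢ` has only zero terms. -/
theorem eq_zero_of_sum_conjTranspose_mul_mul_eq_zero {ι μ ν : Type*} [Fintype ι] [Fintype μ]
    [Fintype ν] {Q : Matrix μ μ ℂ} (hQ : Q.PosDef) {u : ι → Matrix μ ν ℂ}
    (h : ∑ i, (u i)ᴴ * Q * u i = 0) (i : ι) : u i = 0 := by
  refine Matrix.ext_iff_mulVec.2 fun x => ?_
  rw [Matrix.zero_mulVec]
  have hterm : ∀ j, star x ⬝ᵥ (((u j)ᴴ * Q * u j) *ᵥ x) =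
      star (u j *ᵥ x) ⬝ᵥ (Q *ᵥ (u j *ᵥ x)) := by
    intro j
    rw [Matrix.star_mulVec, ← Matrix.dotProduct_mulVec, Matrix.mulVec_mulVec, Matrix.mulVec_mulVec]
  have hsum : ∑ j, star (u j *ᵥ x) ⬝ᵥ (Q *ᵥ (u j *ᵥ x)) = 0 := by
    simp only [← hterm]
    rw [← dotProduct_sum, ← Matrix.sum_mulVec, h, Matrix.zero_mulVec, dotProduct_zero]
  have hi := (Finset.sum_eq_zero_iff_of_nonneg fun j _ =>
    hQ.posSemidef.dotProduct_mulVec_nonneg (u j *ᵥ x)).1 hsum i (Finset.mem_univ i)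
  by_contra hne
  exact (hQ.dotProduct_mulVec_pos hne).ne' hi

/-- **Lemma 3.4.**  For `Λ ∈ G_δ ∩ M_n^d`, the cone
`C_Λ = { ∑ᵢ uᵢ(Λ)* (I − δ(Λ)*δ(Λ)) uᵢ(Λ) }`, over all finite families of
`L(ℂ,ℂ^J)`-valued nc polynomials `uᵢ`, is closed in `M_n(ℂ)`. -/
theorem cone_isClosed {d J n : ℕ} (hd : 0 < d) (hn : 0 < n)
    (δ : Matrix (Fin J) (Fin J) (FreeAlgebra ℂ (Fin d)))
    (Λ : MatTuple d n) (hΛ : Λ ∈ Gdel δ n) :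
    IsClosed {A : Matrix (Fin n) (Fin n) ℂ |
      ∃ (N : ℕ) (u : Fin N → Fin J → FreeAlgebra ℂ (Fin d)),
        A = ∑ i : Fin N, (colEval (u i) Λ)ᴴ *
          ((1 : Matrix (Fin J × Fin n) (Fin J × Fin n) ℂ) - (evalMat δ Λ)ᴴ * evalMat δ Λ) *
            colEval (u i) Λ} := by
  set Q := (1 : Matrix (Fin J × Fin n) (Fin J × Fin n) ℂ) - (evalMat δ Λ)ᴴ * evalMat δ Λ
  let V := LinearMap.range (colEvalLin J Λ)
  let k := Module.finrank ℂ V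
  let b : Module.Basis (Fin k) ℂ V := Module.finBasis ℂ V
  let S : (Fin k → Fin k → ℂ) → Matrix (Fin n) (Fin n) ℂ := fun B =>
    ∑ i, (∑ j, B i j • (b j : Matrix (Fin J × Fin n) (Fin n) ℂ))ᴴ * Q *
      (∑ j, B i j • (b j : Matrix (Fin J × Fin n) (Fin n) ℂ))
  have hSclosed : IsClosed (Set.range S) := by
    let _ : NormedAddCommGroup (Matrix (Fin n) (Fin n) ℂ) := Matrix.normedAddCommGroup
    let _ : NormedSpace ℝ (Matrix (Fin n) (Fin n) ℂ) := Matrix.normedSpace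
    have : ProperSpace (Matrix (Fin n) (Fin n) ℂ) := FiniteDimensional.proper ℝ _
    refine isClosed_range_of_sq_homogeneous (f := S) ?_ ?_ ?_
    · fun_prop
    · intro t B
      simp only [S, Finset.smul_sum]
      refine Finset.sum_congr rfl fun i _ => ?_
      have : ∑ j, (t • B) i j • (b j : Matrix (Fin J × Fin n) (Fin n) ℂ) =
          t • ∑ j, B i j • (b j : Matrix (Fin J × Fin n) (Fin n) ℂ) := by
        rw [Finset.smul_sum]
        exact Finset.sum_congr rfl fun j _ => smul_assoc t (B i j) _
      rw [this, Matrix.conjTranspose_smul, Matrix.smul_mul, Matrix.smul_mul, Matrix.mul_smul,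
        smul_smul, star_trivial, sq]
    · intro B hB
      have hz := eq_zero_of_sum_conjTranspose_mul_mul_eq_zero
        (posDef_one_sub_conjTranspose_mul_self hΛ) hB
      funext i j
      have hi : ∑ j, B i j • b j = 0 := by
        apply Subtype.ext
        simpa using hz i
      exact Fintype.linearIndependent_iff.1 b.linearIndependent (B i) hi j
  convert hSclosed using 1
  ext A
  constructor
  · rintro ⟨N, u, rfl⟩
    let C : Matrix (Fin N) (Fin k) ℂ := fun i j => b.repr ⟨colEval (u i) Λ, u i, rfl⟩ j
    have hu : ∀ i, colEval (u i) Λ = ∑ j, C i j • (b j : Matrix (Fin J × Fin n) (Fin n) ℂ) := by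
      intro i
      have := congrArg V.subtype (b.sum_repr ⟨colEval (u i) Λ, u i, rfl⟩)
      rw [map_sum] at this
      exact this.symm
    obtain ⟨B, hB⟩ := exists_conjTranspose_mul_self_eq_square C
    refine ⟨B, ?_⟩
    simp only [hu]
    rw [sum_conjTranspose_mul_mul_eq _ Q C, hB]
    exact sum_conjTranspose_mul_mul_eq _ Q B
  · rintro ⟨B, rfl⟩
    choose u hu using fun i => (∑ j, B i j • b j).2
    refine ⟨k, u, Finset.sum_congr rfl fun i _ => ?_⟩
    have : colEval (u i) Λ = ∑ j, B i j • (b j : Matrix (Fin J × Fin n) (Fin n) ℂ) := by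
      refine (hu i).trans ?_
      simp
    rw [this]
end

section
/- Let δ be a J×J matrix of free polynomials, let Λ ∈ G_δ ∩ M_n^d, let p₀ ∈ P^d, let N' ≥ 1, and let u be a JN'×1 column of free polynomials such that for all x, y ∈ V_Λ ∩ G_δ ∩ M_n^d, I_n − p₀(y)* p₀(x) = u(y)* [I_{nJN'} − (δ(y)* ⊗ I_{ℂ^{N'}})(δ(x) ⊗ I_{ℂ^{N'}})] u(x) (up to the canonical identifications of tensor factors). Then there exists a unitary V ∈ M_{1+JN'}(ℂ), written V = [[A, B],[C, D]] with respect to the decomposition ℂ ⊕ ℂ^{JN'}, such that the block matrix [[I_n⊗A, I_n⊗B],[I_n⊗C, I_n⊗D]] applied to the block column [I_n ; (δ(Λ) ⊗ I_{ℂ^{N'}}) u(Λ)] equals the block column [p₀(Λ) ; u(Λ)]. -/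
open Matrix

noncomputable section

/-- The block column `[I_n ; (δ(Λ) ⊗ I_{ℂ^K}) u(Λ)]`. -/
noncomputable def blockColIn {d n J K : ℕ}
    (δ : Matrix (Fin J) (Fin J) (FreeAlgebra ℂ (Fin d)))
    (u : Fin J × Fin K → FreeAlgebra ℂ (Fin d)) (Λ : MatTuple d n) :
    Matrix ((Unit ⊕ Fin J × Fin K) × Fin n) (Fin n) ℂ :=
  fun a q =>
    match a.1 with
    | Sum.inl _ => (1 : Matrix (Fin n) (Fin n) ℂ) a.2 q
    | Sum.inr jk => (dTensorEval δ K Λ * colEvalJK u Λ) (jk, a.2) q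

/-- The block column `[p₀(Λ) ; u(Λ)]`. -/
noncomputable def blockColOut {d n J K : ℕ} (p₀ : FreeAlgebra ℂ (Fin d))
    (u : Fin J × Fin K → FreeAlgebra ℂ (Fin d)) (Λ : MatTuple d n) :
    Matrix ((Unit ⊕ Fin J × Fin K) × Fin n) (Fin n) ℂ :=
  fun a q =>
    match a.1 with
    | Sum.inl _ => evalPoly p₀ Λ a.2 q
    | Sum.inr jk => colEvalJK u Λ (jk, a.2) q

end
open Filter Topology

/-- Two matrices with the same Gram matrix differ by a unitary factor on the left. -/
theorem exists_unitary_mul_eq_of_conjTranspose_mul_self_eq {ι κ : Type*} [Fintype ι]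
    [DecidableEq ι] [Fintype κ] (A B : Matrix ι κ ℂ) (h : Aᴴ * A = Bᴴ * B) :
    ∃ V ∈ Matrix.unitaryGroup ι ℂ, V * A = B := by
  classical
  set f := toEuclideanLin (𝕜 := ℂ) A with hf
  set g := toEuclideanLin (𝕜 := ℂ) B with hg
  have norm_eq (x : EuclideanSpace ℂ κ) : ‖f x‖ = ‖g x‖ := by
    have key : inner ℂ (f x) (f x) = inner ℂ (g x) (g x) := by
      rw [← LinearMap.adjoint_inner_right, ← LinearMap.adjoint_inner_right, hf, hg,
        ← toEuclideanLin_conjTranspose_eq_adjoint, ← toEuclideanLin_conjTranspose_eq_adjoint]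
      simp only [toLpLin_apply, mulVec_mulVec, h]
    rw [@norm_eq_sqrt_re_inner ℂ, @norm_eq_sqrt_re_inner ℂ, key]
  obtain ⟨s, hs⟩ := f.rangeRestrict.exists_rightInverse_of_surjective f.range_rangeRestrict
  have f_comp_s (y : LinearMap.range f) : f (s y) = y :=
    congrArg Subtype.val (LinearMap.congr_fun hs y)
  let L : LinearMap.range f →ₗᵢ[ℂ] EuclideanSpace ℂ ι :=
    ⟨g ∘ₗ s, fun y => by
      rw [LinearMap.comp_apply, ← norm_eq, f_comp_s, Submodule.coe_norm]⟩
  let U := L.extend.toLinearIsometryEquiv rfl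
  have map_eq (x : EuclideanSpace ℂ κ) : U (f x) = g x := by
    have hU : U (f x) = g (s ⟨f x, x, rfl⟩) := L.extend_apply ⟨f x, x, rfl⟩
    rw [hU, ← sub_eq_zero, ← map_sub, ← norm_eq_zero, ← norm_eq, map_sub, f_comp_s, sub_self,
      norm_zero]
  refine ⟨_, U.toMatrix_mem_unitaryGroup (EuclideanSpace.basisFun ι ℂ)
    (EuclideanSpace.basisFun ι ℂ), ?_⟩
  apply (toEuclideanLin (𝕜 := ℂ)).injective
  ext1 x
  rw [← hg, ← map_eq, hf]
  generalize hM : LinearMap.toMatrix (EuclideanSpace.basisFun ι ℂ).toBasis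
    (EuclideanSpace.basisFun ι ℂ).toBasis _ = M
  have hMU : toEuclideanLin M = (U.toLinearEquiv : EuclideanSpace ℂ ι →ₗ[ℂ] _) := by
    rw [toEuclideanLin_eq_toLin_orthonormal, ← hM, toLin_toMatrix]
  have := LinearMap.congr_fun hMU (toEuclideanLin A x)
  simpa [toLpLin_apply] using this

/-- Two finite Kraus families defining the same completely positive map are related by a
unitary matrix of scalars. -/
theorem exists_unitary_of_sum_conjTranspose_mul_mul_eq {ι m : Type*} [Fintype ι]
    [DecidableEq ι] [Fintype m] [DecidableEq m] (W Z : ι → Matrix m m ℂ)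
    (h : ∀ k, ∑ i, (W i)ᴴ * k * W i = ∑ i, (Z i)ᴴ * k * Z i) :
    ∃ V ∈ Matrix.unitaryGroup ι ℂ, ∀ i, ∑ j, V i j • W j = Z i := by
  obtain ⟨V, hV, hVA⟩ := exists_unitary_mul_eq_of_conjTranspose_mul_self_eq
    (Matrix.of fun i (a : m × m) => W i a.1 a.2) (Matrix.of fun i (a : m × m) => Z i a.1 a.2) (by
      ext a b
      have := congrFun (congrFun (h (Matrix.single a.1 b.1 1)) a.2) b.2
      simpa [Matrix.sum_apply, Matrix.mul_apply, Matrix.single_apply, ite_and] using this)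
  refine ⟨V, hV, fun i => ?_⟩
  ext a q
  simpa [Matrix.mul_apply, Matrix.sum_apply] using congrFun (congrFun hVA i) (a, q)

theorem evalPoly_conj {d n : ℕ} (p : FreeAlgebra ℂ (Fin d)) (x : MatTuple d n)
    {h k : Matrix (Fin n) (Fin n) ℂ} (hk : h * k = 1) :
    evalPoly p (fun r => h * x r * k) = h * evalPoly p x * k := by
  have kh : k * h = 1 := mul_eq_one_comm.mp hk
  unfold evalPoly
  induction p using FreeAlgebra.induction with
  | grade0 c => simp [Algebra.algebraMap_eq_smul_one, hk]
  | grade1 r => simp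
  | mul p q hp hq =>
    rw [map_mul, map_mul, hp, hq]
    simp only [mul_assoc]
    rw [← mul_assoc k h, kh, one_mul]
  | add p q hp hq => rw [map_add, map_add, hp, hq, mul_add, add_mul]

theorem continuous_evalPoly {d n : ℕ} (p : FreeAlgebra ℂ (Fin d)) :
    Continuous fun x : MatTuple d n => evalPoly p x := by
  unfold evalPoly
  induction p using FreeAlgebra.induction with
  | grade0 c => simpa using continuous_const
  | grade1 r => simpa using continuous_apply r
  | mul p q hp hq => simp only [map_mul]; exact hp.mul hq
  | add p q hp hq => simp only [map_add]; exact hp.add hq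

theorem continuous_opNorm {ι : Type*} [Fintype ι] [DecidableEq ι] :
    Continuous fun A : Matrix ι ι ℂ => opNorm A :=
  continuous_norm.comp (LinearMap.continuous_of_finiteDimensional
    (Matrix.toEuclideanCLM (n := ι) (𝕜 := ℂ)).toAlgEquiv.toLinearMap)

theorem isOpen_Gdel {d J : ℕ} (δ : Matrix (Fin J) (Fin J) (FreeAlgebra ℂ (Fin d))) (n : ℕ) :
    IsOpen (Gdel δ n) :=
  isOpen_lt (continuous_opNorm.comp <| continuous_matrix fun a b =>
    (continuous_evalPoly (δ a.1 b.1)).matrix_elem a.2 b.2) continuous_const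

/-- Every direction `k` admits arbitrarily small perturbations `1 + ε k` of the identity that
conjugate a point of an open set of matrix tuples into that set. -/
theorem exists_ne_zero_conj_mem {d n : ℕ} {S : Set (MatTuple d n)} (hS : IsOpen S)
    {x : MatTuple d n} (hx : x ∈ S) (k : Matrix (Fin n) (Fin n) ℂ) :
    ∃ ε : ℂ, ε ≠ 0 ∧ (1 + ε • k) * (1 + ε • k)⁻¹ = 1 ∧
      (fun r => (1 + ε • k) * x r * (1 + ε • k)⁻¹) ∈ S := by
  have hc : Continuous fun ε : ℂ => (1 : Matrix (Fin n) (Fin n) ℂ) + ε • k := by fun_prop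
  have hdet : ∀ᶠ ε : ℂ in 𝓝 0, (1 + ε • k).det ≠ 0 :=
    hc.matrix_det.continuousAt.eventually_ne (by simp)
  have hinv : ContinuousAt (fun ε : ℂ => (1 + ε • k)⁻¹) 0 := by
    simp only [Matrix.inv_def, Ring.inverse_eq_inv']
    exact (hc.matrix_det.continuousAt.inv₀ (by simp)).smul hc.matrix_adjugate.continuousAt
  have hconj : ContinuousAt (fun ε : ℂ => fun r => (1 + ε • k) * x r * (1 + ε • k)⁻¹) 0 :=
    continuousAt_pi.mpr fun r => (hc.continuousAt.mul continuousAt_const).mul hinv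
  have hmem := hconj.eventually_mem (hS.mem_nhds (by simpa using hx))
  obtain ⟨ε, ⟨hε, hεS⟩, hε0⟩ :=
    (((hdet.and hmem).filter_mono nhdsWithin_le_nhds).and
      (self_mem_nhdsWithin : {0}ᶜ ∈ 𝓝[≠] (0 : ℂ))).exists
  exact ⟨ε, hε0, Matrix.mul_nonsing_inv _ (isUnit_iff_ne_zero.mpr hε), hεS⟩

theorem conj_mem_VLam {d n : ℕ} (Λ : MatTuple d n) {h k : Matrix (Fin n) (Fin n) ℂ}
    (hk : h * k = 1) : (fun r => h * Λ r * k) ∈ VLam Λ n := fun p hp => by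
  rw [evalPoly_conj p Λ hk, hp, mul_zero, zero_mul]

/-- If `∑ wᵢ(y)* wᵢ(x) = ∑ zᵢ(y)* zᵢ(x)` on the points of an open set where the polynomials
annihilating `Λ` vanish, then `wᵢ(Λ)` and `zᵢ(Λ)` define the same completely positive map. -/
theorem sum_conjTranspose_mul_mul_evalPoly_eq {d n : ℕ} {ι : Type*} [Fintype ι]
    {S : Set (MatTuple d n)} (hS : IsOpen S) {Λ : MatTuple d n} (hΛ : Λ ∈ S)
    (w z : ι → FreeAlgebra ℂ (Fin d))
    (h : ∀ x ∈ VLam Λ n ∩ S, ∀ y ∈ VLam Λ n ∩ S,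
      ∑ i, (evalPoly (w i) y)ᴴ * evalPoly (w i) x = ∑ i, (evalPoly (z i) y)ᴴ * evalPoly (z i) x)
    (k : Matrix (Fin n) (Fin n) ℂ) :
    ∑ i, (evalPoly (w i) Λ)ᴴ * k * evalPoly (w i) Λ =
      ∑ i, (evalPoly (z i) Λ)ᴴ * k * evalPoly (z i) Λ := by
  obtain ⟨ε, hε, hinv, hmem⟩ := exists_ne_zero_conj_mem hS hΛ k
  have hΛ' : Λ ∈ VLam Λ n ∩ S := ⟨fun _ hp => hp, hΛ⟩
  have h1 := h Λ hΛ' Λ hΛ'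
  have h2 := h _ ⟨conj_mem_VLam Λ hinv, hmem⟩ Λ hΛ'
  simp only [evalPoly_conj _ Λ hinv, ← mul_assoc] at h2
  rw [← Finset.sum_mul, ← Finset.sum_mul] at h2
  have h3 := congrArg (· * (1 + ε • k)) h2
  simp only [mul_assoc _ _ (1 + ε • k), mul_eq_one_comm.mp hinv, mul_one] at h3
  simp only [mul_add, add_mul, mul_one, Finset.sum_add_distrib, h1, mul_smul_comm,
    smul_mul_assoc, ← Finset.smul_sum] at h3
  exact smul_right_injective _ hε (add_left_cancel h3)

theorem conjTranspose_colEvalJK_mul {d m J K : ℕ} (u v : Fin J × Fin K → FreeAlgebra ℂ (Fin d))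
    (x y : MatTuple d m) :
    (colEvalJK u y)ᴴ * colEvalJK v x = ∑ i, (evalPoly (u i) y)ᴴ * evalPoly (v i) x := by
  ext a b
  simp only [Matrix.mul_apply, Matrix.sum_apply, Matrix.conjTranspose_apply, colEvalJK]
  exact Fintype.sum_prod_type _

theorem dTensorEval_mul_colEvalJK {d m J K : ℕ}
    (δ : Matrix (Fin J) (Fin J) (FreeAlgebra ℂ (Fin d)))
    (u : Fin J × Fin K → FreeAlgebra ℂ (Fin d)) (x : MatTuple d m) :
    dTensorEval δ K x * colEvalJK u x =
      colEvalJK (fun i => ∑ j, δ i.1 j * u (j, i.2)) x := by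
  ext a b
  simp [Matrix.mul_apply, Matrix.sum_apply, dTensorEval, colEvalJK, evalMat, evalPoly,
    Fintype.sum_prod_type, ite_mul, Finset.sum_ite_irrel]

/-- **The lurking isometry** (from the proof of Theorem 1.3).  If
`I − p₀(y)* p₀(x) = u(y)* (I − (δ(y)* ⊗ I)(δ(x) ⊗ I)) u(x)` for all
`x, y ∈ V_Λ ∩ G_δ ∩ M_n^d`, then there is a unitary
`V = [[A,B],[C,D]] ∈ M_{1+JN'}(ℂ)` with
`[[I⊗A, I⊗B],[I⊗C, I⊗D]] [I_n ; (δ(Λ)⊗I)u(Λ)] = [p₀(Λ) ; u(Λ)]`. -/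
theorem lurking_isometry {d J n N' : ℕ} (hd : 0 < d) (hn : 0 < n) (hN' : 0 < N')
    (δ : Matrix (Fin J) (Fin J) (FreeAlgebra ℂ (Fin d)))
    (Λ : MatTuple d n) (hΛ : Λ ∈ Gdel δ n) (p₀ : FreeAlgebra ℂ (Fin d))
    (u : Fin J × Fin N' → FreeAlgebra ℂ (Fin d))
    (hrep : ∀ x ∈ VLam Λ n ∩ Gdel δ n, ∀ y ∈ VLam Λ n ∩ Gdel δ n,
      (1 : Matrix (Fin n) (Fin n) ℂ) - (evalPoly p₀ y)ᴴ * evalPoly p₀ x =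
        (colEvalJK u y)ᴴ *
          ((1 : Matrix ((Fin J × Fin N') × Fin n) ((Fin J × Fin N') × Fin n) ℂ) -
            (dTensorEval δ N' y)ᴴ * dTensorEval δ N' x) * colEvalJK u x) :
    ∃ V : Matrix (Unit ⊕ Fin J × Fin N') (Unit ⊕ Fin J × Fin N') ℂ,
      V ∈ Matrix.unitaryGroup (Unit ⊕ Fin J × Fin N') ℂ ∧
      ampliate n V * blockColIn δ u Λ = blockColOut p₀ u Λ := by
  let w : Unit ⊕ Fin J × Fin N' → FreeAlgebra ℂ (Fin d) :=
    Sum.elim (fun _ => 1) fun i => ∑ j, δ i.1 j * u (j, i.2)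
  let z : Unit ⊕ Fin J × Fin N' → FreeAlgebra ℂ (Fin d) := Sum.elim (fun _ => p₀) u
  have hwz : ∀ x ∈ VLam Λ n ∩ Gdel δ n, ∀ y ∈ VLam Λ n ∩ Gdel δ n,
      ∑ i, (evalPoly (w i) y)ᴴ * evalPoly (w i) x =
        ∑ i, (evalPoly (z i) y)ᴴ * evalPoly (z i) x := by
    intro x hx y hy
    have h := hrep x hx y hy
    rw [Matrix.mul_sub, Matrix.sub_mul, Matrix.mul_one, ← Matrix.mul_assoc,
      ← Matrix.conjTranspose_mul, Matrix.mul_assoc, dTensorEval_mul_colEvalJK,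
      dTensorEval_mul_colEvalJK, conjTranspose_colEvalJK_mul, conjTranspose_colEvalJK_mul,
      sub_eq_sub_iff_add_eq_add] at h
    have h_one (t : MatTuple d n) : evalPoly 1 t = 1 := map_one _
    simpa [w, z, h_one, add_comm] using h
  obtain ⟨V, hV, hVw⟩ := exists_unitary_of_sum_conjTranspose_mul_mul_eq
    (fun i => evalPoly (w i) Λ) (fun i => evalPoly (z i) Λ)
    (sum_conjTranspose_mul_mul_evalPoly_eq (isOpen_Gdel δ n) hΛ w z hwz)
  have h_in (i) (a q : Fin n) : blockColIn δ u Λ (i, a) q = evalPoly (w i) Λ a q := by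
    rcases i with _ | i
    · simp [blockColIn, w, evalPoly]
    · simp only [blockColIn, dTensorEval_mul_colEvalJK]
      rfl
  have h_out (i) (a q : Fin n) : blockColOut p₀ u Λ (i, a) q = evalPoly (z i) Λ a q := by
    rcases i with _ | i <;> rfl
  refine ⟨V, hV, ?_⟩
  ext ⟨i, a⟩ q
  rw [h_out, ← hVw, Matrix.mul_apply, Fintype.sum_prod_type, Matrix.sum_apply]
  simp [ampliate, h_in]
end

section
/- Let δ be a J×J matrix of free polynomials, let K ≥ 1, and let V = [[A, B],[C, D]] be an isometry of ℂ ⊕ ℂ^{JK} into itself, decomposed with A : ℂ → ℂ, B : ℂ^{JK} → ℂ, C : ℂ → ℂ^{JK}, D : ℂ^{JK} → ℂ^{JK}. Then: (1) for every m ≥ 1 and every x ∈ G_δ ∩ M_m^d, the matrix I_{mJK} − (I_m⊗D)(δ(x) ⊗ I_{ℂ^K}) is invertible, and the transfer function φ(x) = I_m⊗A + (I_m⊗B)(δ(x) ⊗ I_{ℂ^K})[I_{mJK} − (I_m⊗D)(δ(x) ⊗ I_{ℂ^K})]⁻¹(I_m⊗C) satisfies ‖φ(x)‖ ≤ 1;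 (2) if moreover Λ ∈ G_δ ∩ M_n^d, p₀ ∈ P^d, and u is a JK×1 column of free polynomials such that [[I_n⊗A, I_n⊗B],[I_n⊗C, I_n⊗D]] applied to the block column [I_n ; (δ(Λ) ⊗ I_{ℂ^K}) u(Λ)] equals [p₀(Λ) ; u(Λ)], then φ(Λ) = p₀(Λ). -/
open Matrix

noncomputable section

/-- The matrix `I_{mJK} − (I_m ⊗ D)(δ(x) ⊗ I_{ℂ^K})`, where `D` is the lower-right
corner of `V` with respect to the decomposition `ℂ ⊕ ℂ^{JK}`. -/
noncomputable def resolventMat {d J K m : ℕ}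
    (δ : Matrix (Fin J) (Fin J) (FreeAlgebra ℂ (Fin d)))
    (V : Matrix (Unit ⊕ Fin J × Fin K) (Unit ⊕ Fin J × Fin K) ℂ)
    (x : MatTuple d m) :
    Matrix ((Fin J × Fin K) × Fin m) ((Fin J × Fin K) × Fin m) ℂ :=
  1 - ampliate m (fun p q => V (Sum.inr p) (Sum.inr q)) * dTensorEval δ K x

/-- The transfer function
`φ(x) = I_m ⊗ A + (I_m ⊗ B)(δ(x) ⊗ I_K)(I − (I_m ⊗ D)(δ(x) ⊗ I_K))⁻¹ (I_m ⊗ C)`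
of `V = [[A,B],[C,D]]` (with respect to the decomposition `ℂ ⊕ ℂ^{JK}`). -/
noncomputable def transferFn {d J K m : ℕ}
    (δ : Matrix (Fin J) (Fin J) (FreeAlgebra ℂ (Fin d)))
    (V : Matrix (Unit ⊕ Fin J × Fin K) (Unit ⊕ Fin J × Fin K) ℂ)
    (x : MatTuple d m) : Matrix (Fin m) (Fin m) ℂ :=
  V (Sum.inl ()) (Sum.inl ()) • (1 : Matrix (Fin m) (Fin m) ℂ) +
    (Matrix.of fun (q : Fin m) (a : (Fin J × Fin K) × Fin m) =>
        if q = a.2 then V (Sum.inl ()) (Sum.inr a.1) else 0) *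
      dTensorEval δ K x * (resolventMat δ V x)⁻¹ *
      (Matrix.of fun (a : (Fin J × Fin K) × Fin m) (q : Fin m) =>
        if a.2 = q then V (Sum.inr a.1) (Sum.inl ()) else 0)

end
/-- The squared Euclidean norm of a complex vector. -/
noncomputable def vecNormSq {ι : Type*} [Fintype ι] (v : ι → ℂ) : ℝ := ∑ i, ‖v i‖ ^ 2

lemma vecNormSq_nonneg {ι : Type*} [Fintype ι] (v : ι → ℂ) : 0 ≤ vecNormSq v :=
  Finset.sum_nonneg fun _ _ => by positivity

lemma eq_zero_of_vecNormSq_le_zero {ι : Type*} [Fintype ι] {v : ι → ℂ}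
    (h : vecNormSq v ≤ 0) : v = 0 := by
  have h0 := le_antisymm h (vecNormSq_nonneg v)
  rw [vecNormSq, Finset.sum_eq_zero_iff_of_nonneg (fun _ _ => by positivity)] at h0
  funext i
  simpa using h0 i (Finset.mem_univ i)

lemma norm_toLp_sq_eq_vecNormSq {ι : Type*} [Fintype ι] (v : ι → ℂ) :
    ‖WithLp.toLp 2 v‖ ^ 2 = vecNormSq v := by
  rw [EuclideanSpace.norm_sq_eq]; rfl

lemma vecNormSq_mulVec_le {ι : Type*} [Fintype ι] [DecidableEq ι] (M : Matrix ι ι ℂ)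
    (v : ι → ℂ) : vecNormSq (M *ᵥ v) ≤ opNorm M ^ 2 * vecNormSq v := by
  have h := (Matrix.toEuclideanCLM (𝕜 := ℂ) M).le_opNorm (WithLp.toLp 2 v)
  rw [Matrix.toEuclideanCLM_toLp] at h
  rw [← norm_toLp_sq_eq_vecNormSq, ← norm_toLp_sq_eq_vecNormSq, ← mul_pow]
  exact pow_le_pow_left₀ (norm_nonneg _) h 2

lemma opNorm_le_one {ι : Type*} [Fintype ι] [DecidableEq ι] {M : Matrix ι ι ℂ}
    (h : ∀ v, vecNormSq (M *ᵥ v) ≤ vecNormSq v) : opNorm M ≤ 1 := by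
  refine ContinuousLinearMap.opNorm_le_bound _ zero_le_one fun v => ?_
  obtain ⟨v⟩ := v
  rw [Matrix.toEuclideanCLM_toLp, one_mul]
  refine le_of_sq_le_sq ?_ (norm_nonneg _)
  rw [norm_toLp_sq_eq_vecNormSq, norm_toLp_sq_eq_vecNormSq]
  exact h v

lemma vecNormSq_mulVec_of_isometry {ι : Type*} [Fintype ι] [DecidableEq ι] {V : Matrix ι ι ℂ}
    (hV : Vᴴ * V = 1) (v : ι → ℂ) : vecNormSq (V *ᵥ v) = vecNormSq v := by
  have key : ∀ w : ι → ℂ, ((vecNormSq w : ℝ) : ℂ) = star w ⬝ᵥ w := fun w => by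
    simp [vecNormSq, dotProduct, Complex.conj_mul']
  have h : ((vecNormSq (V *ᵥ v) : ℝ) : ℂ) = vecNormSq v := by
    rw [key, key, Matrix.star_mulVec, ← Matrix.dotProduct_mulVec, Matrix.mulVec_mulVec, hV,
      Matrix.one_mulVec]
  exact_mod_cast h

section Realization

variable {q M : Type*} [Fintype q] [Fintype M] [DecidableEq M]
  {A : Matrix q q ℂ} {B : Matrix q M ℂ} {C : Matrix M q ℂ} {D T : Matrix M M ℂ}

lemma isUnit_one_sub_mul_of_isometry
    (hI : ∀ h y, vecNormSq (A *ᵥ h + B *ᵥ y) + vecNormSq (C *ᵥ h + D *ᵥ y) =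
      vecNormSq h + vecNormSq y)
    {c : ℝ} (hc : c < 1) (hT : ∀ w, vecNormSq (T *ᵥ w) ≤ c * vecNormSq w) :
    IsUnit (1 - D * T) := by
  rw [← Matrix.mulVec_injective_iff_isUnit]
  refine (injective_iff_map_eq_zero (Matrix.mulVecLin (1 - D * T))).2 fun w hw => ?_
  have hw' : D *ᵥ (T *ᵥ w) = w := by
    rw [Matrix.mulVecLin_apply, Matrix.sub_mulVec, Matrix.one_mulVec, sub_eq_zero] at hw
    rw [Matrix.mulVec_mulVec]; exact hw.symm
  have h1 := hI 0 (T *ᵥ w)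
  rw [Matrix.mulVec_zero, Matrix.mulVec_zero, zero_add, zero_add, hw'] at h1
  have h0 : vecNormSq (0 : q → ℂ) = 0 := by simp [vecNormSq]
  have h2 := vecNormSq_nonneg (B *ᵥ (T *ᵥ w))
  have h3 := hT w
  refine eq_zero_of_vecNormSq_le_zero ?_
  nlinarith

lemma vecNormSq_realization_le
    (hI : ∀ h y, vecNormSq (A *ᵥ h + B *ᵥ y) + vecNormSq (C *ᵥ h + D *ᵥ y) =
      vecNormSq h + vecNormSq y)
    {c : ℝ} (hc : c < 1) (hT : ∀ w, vecNormSq (T *ᵥ w) ≤ c * vecNormSq w) (h : q → ℂ) :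
    vecNormSq ((A + B * T * (1 - D * T)⁻¹ * C) *ᵥ h) ≤ vecNormSq h := by
  have hu := (Matrix.isUnit_iff_isUnit_det _).1 (isUnit_one_sub_mul_of_isometry hI hc hT)
  set w := (1 - D * T)⁻¹ *ᵥ (C *ᵥ h) with hw
  have hw' : C *ᵥ h + D *ᵥ (T *ᵥ w) = w := by
    have : (1 - D * T) *ᵥ w = C *ᵥ h := by
      rw [hw, Matrix.mulVec_mulVec, Matrix.mul_nonsing_inv _ hu, Matrix.one_mulVec]
    rw [← this, Matrix.sub_mulVec, Matrix.one_mulVec, ← Matrix.mulVec_mulVec, sub_add_cancel]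
  have hφ : (A + B * T * (1 - D * T)⁻¹ * C) *ᵥ h = A *ᵥ h + B *ᵥ (T *ᵥ w) := by
    simp only [hw, Matrix.add_mulVec, Matrix.mulVec_mulVec, Matrix.mul_assoc]
  have h1 := hI h (T *ᵥ w)
  rw [hw'] at h1
  have h2 := hT w
  have h3 := vecNormSq_nonneg w
  rw [hφ]
  nlinarith

end Realization

lemma vecNormSq_dTensorEval_le {d m J K : ℕ}
    (δ : Matrix (Fin J) (Fin J) (FreeAlgebra ℂ (Fin d))) (x : MatTuple d m)
    (w : (Fin J × Fin K) × Fin m → ℂ) :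
    vecNormSq (dTensorEval δ K x *ᵥ w) ≤ opNorm (evalMat δ x) ^ 2 * vecNormSq w := by
  have hslice : ∀ v : (Fin J × Fin K) × Fin m → ℂ,
      vecNormSq v = ∑ k, vecNormSq fun a : Fin J × Fin m => v ((a.1, k), a.2) := fun v => by
    simp only [vecNormSq, Fintype.sum_prod_type]
    exact Finset.sum_comm
  have hmul : ∀ k, (fun a : Fin J × Fin m => (dTensorEval δ K x *ᵥ w) ((a.1, k), a.2)) =
      evalMat δ x *ᵥ fun a => w ((a.1, k), a.2) := fun k => by
    funext a
    simp only [Matrix.mulVec, dotProduct, dTensorEval, Fintype.sum_prod_type, ite_mul, zero_mul]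
    refine Finset.sum_congr rfl fun j _ => ?_
    rw [Finset.sum_comm]
    simp
  rw [hslice, hslice w, Finset.mul_sum]
  refine Finset.sum_le_sum fun k _ => ?_
  rw [hmul]
  exact vecNormSq_mulVec_le _ _

section Blocks

variable {ι : Type*} (n : ℕ) (V : Matrix (Unit ⊕ ι) (Unit ⊕ ι) ℂ)

/-- The block `I_n ⊗ B` of the ampliation of `[[A, B], [C, D]]`. -/
def ampliateRow : Matrix (Fin n) (ι × Fin n) ℂ :=
  Matrix.of fun q a => if q = a.2 then V (Sum.inl ()) (Sum.inr a.1) else 0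

/-- The block `I_n ⊗ C` of the ampliation of `[[A, B], [C, D]]`. -/
def ampliateCol : Matrix (ι × Fin n) (Fin n) ℂ :=
  Matrix.of fun a q => if a.2 = q then V (Sum.inr a.1) (Sum.inl ()) else 0

variable [Fintype ι] [DecidableEq ι] {n V}

lemma vecNormSq_ampliate_blocks (hV : Vᴴ * V = 1) (h : Fin n → ℂ) (y : ι × Fin n → ℂ) :
    vecNormSq ((V (Sum.inl ()) (Sum.inl ()) • (1 : Matrix (Fin n) (Fin n) ℂ)) *ᵥ h +
        ampliateRow n V *ᵥ y) +
      vecNormSq (ampliateCol n V *ᵥ h +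
        ampliate n (fun p q => V (Sum.inr p) (Sum.inr q)) *ᵥ y) =
      vecNormSq h + vecNormSq y := by
  have hcol : ∀ i, vecNormSq (V *ᵥ Sum.elim (fun _ => h i) fun p => y (p, i)) =
      ‖h i‖ ^ 2 + ∑ p, ‖y (p, i)‖ ^ 2 := fun i => by
    rw [vecNormSq_mulVec_of_isometry hV]
    simp [vecNormSq]
  have htop : ∀ i, ((V (Sum.inl ()) (Sum.inl ()) • (1 : Matrix (Fin n) (Fin n) ℂ)) *ᵥ h +
      ampliateRow n V *ᵥ y) i =
      (V *ᵥ Sum.elim (fun _ => h i) fun p => y (p, i)) (Sum.inl ()) := fun i => by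
    simp [Matrix.smul_mulVec, ampliateRow, Matrix.mulVec, dotProduct, Fintype.sum_prod_type]
  have hbot : ∀ p i, (ampliateCol n V *ᵥ h +
      ampliate n (fun p q => V (Sum.inr p) (Sum.inr q)) *ᵥ y) (p, i) =
      (V *ᵥ Sum.elim (fun _ => h i) fun p => y (p, i)) (Sum.inr p) := fun p i => by
    simp [ampliateCol, ampliate, Matrix.mulVec, dotProduct, Fintype.sum_prod_type]
  have hsum : vecNormSq h + vecNormSq y =
      ∑ i, vecNormSq (V *ᵥ Sum.elim (fun _ => h i) fun p => y (p, i)) := by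
    simp only [hcol, Finset.sum_add_distrib]
    rw [Finset.sum_comm]
    simp only [vecNormSq, Fintype.sum_prod_type]
  rw [hsum]
  simp only [vecNormSq, Fintype.sum_prod_type, htop, hbot, Fintype.sum_sum_type,
    Finset.univ_unique, Finset.sum_singleton, Finset.sum_add_distrib]
  rw [Finset.sum_comm (s := (Finset.univ : Finset ι))]

end Blocks

/-- **Transfer functions of isometries** (from the proof of Theorem 1.3, via
Theorem 2.3).  If `V = [[A,B],[C,D]]` is an isometry of `ℂ ⊕ ℂ^{JK}`, then for every
`x ∈ G_δ` the matrix `I − (I⊗D)(δ(x)⊗I_K)` is invertible and the transfer function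
satisfies `‖φ(x)‖ ≤ 1`; and if moreover
`[[I⊗A, I⊗B],[I⊗C, I⊗D]] [I_n ; (δ(Λ)⊗I_K)u(Λ)] = [p₀(Λ) ; u(Λ)]`,
then `φ(Λ) = p₀(Λ)`. -/
theorem transferFn_contractive_and_interpolates {d J K : ℕ} (hd : 0 < d) (hK : 0 < K)
    (δ : Matrix (Fin J) (Fin J) (FreeAlgebra ℂ (Fin d)))
    (V : Matrix (Unit ⊕ Fin J × Fin K) (Unit ⊕ Fin J × Fin K) ℂ)
    (hV : Vᴴ * V = 1) :
    (∀ m, 0 < m → ∀ x ∈ Gdel δ m,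
      IsUnit (resolventMat δ V x) ∧ opNorm (transferFn δ V x) ≤ 1) ∧
    (∀ n, 0 < n → ∀ Λ : MatTuple d n, Λ ∈ Gdel δ n →
      ∀ (p₀ : FreeAlgebra ℂ (Fin d)) (u : Fin J × Fin K → FreeAlgebra ℂ (Fin d)),
        ampliate n V * blockColIn δ u Λ = blockColOut p₀ u Λ →
        transferFn δ V Λ = evalPoly p₀ Λ) := by
  have hI := fun m => vecNormSq_ampliate_blocks (n := m) hV
  have hT : ∀ m, ∀ x ∈ Gdel δ m, opNorm (evalMat δ x) ^ 2 < 1 := fun m x hx =>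
    pow_lt_one₀ (norm_nonneg _) hx two_ne_zero
  have hunit : ∀ m, ∀ x ∈ Gdel δ m, IsUnit (resolventMat δ V x) := fun m x hx =>
    isUnit_one_sub_mul_of_isometry (hI m) (hT m x hx) (vecNormSq_dTensorEval_le δ x)
  refine ⟨fun m _ x hx => ⟨hunit m x hx, opNorm_le_one fun h => ?_⟩,
    fun n _ Λ hΛ p₀ u hu => ?_⟩
  · exact vecNormSq_realization_le (hI m) (hT m x hx) (vecNormSq_dTensorEval_le δ x) h
  · have hbot : ampliateCol n V + ampliate n (fun p q => V (Sum.inr p) (Sum.inr q)) *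
        (dTensorEval δ K Λ * colEvalJK u Λ) = colEvalJK u Λ := by
      ext ⟨p, i⟩ q
      have := congrFun (congrFun hu (Sum.inr p, i)) q
      rw [Matrix.mul_apply] at this
      rw [Matrix.add_apply, Matrix.mul_apply]
      simpa [Fintype.sum_prod_type, blockColIn, blockColOut, ampliate, ampliateCol,
        Matrix.one_apply] using this
    have htop : V (Sum.inl ()) (Sum.inl ()) • (1 : Matrix (Fin n) (Fin n) ℂ) +
        ampliateRow n V * (dTensorEval δ K Λ * colEvalJK u Λ) = evalPoly p₀ Λ := by
      ext i q
      have := congrFun (congrFun hu (Sum.inl (), i)) q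
      rw [Matrix.mul_apply] at this
      rw [Matrix.add_apply, Matrix.mul_apply]
      simpa [Fintype.sum_prod_type, blockColIn, blockColOut, ampliate, ampliateRow,
        Matrix.one_apply] using this
    have hres : resolventMat δ V Λ * colEvalJK u Λ = ampliateCol n V := by
      rw [resolventMat, Matrix.sub_mul, Matrix.one_mul, Matrix.mul_assoc, sub_eq_iff_eq_add]
      exact hbot.symm
    have hsol : (resolventMat δ V Λ)⁻¹ * ampliateCol n V = colEvalJK u Λ := by
      rw [← hres, Matrix.nonsing_inv_mul_cancel_left _ _
        ((Matrix.isUnit_iff_isUnit_det _).1 (hunit n Λ hΛ))]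
    rw [← htop, ← hsol]
    simp only [← Matrix.mul_assoc]
    rfl
end

section
/- Let D be a nonempty free open set in M^d and let φ be a graded function on D. Then φ is a free holomorphic function on D if and only if φ is locally uniformly approximable by free polynomials, i.e., for every x ∈ D there exist a basic free open set G_δ with x ∈ G_δ ⊆ D and a sequence (p_k) in P^d such that sup{‖p_k(y) − φ(y)‖ : y ∈ G_δ} → 0 as k → ∞. -/
namespace FreeHolo

open Matrix
open scoped Matrix.Norms.L2Operator InnerProductSpace

section MatrixNorm

variable {ι κ μ : Type*} [Fintype ι] [DecidableEq ι] [Fintype κ] [DecidableEq κ]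
  [Fintype μ] [DecidableEq μ]

lemma opNorm_eq_norm (A : Matrix ι ι ℂ) : opNorm A = ‖A‖ := rfl

lemma sum_sq_mulVec_le (A : Matrix ι ι ℂ) (v : ι → ℂ) :
    ∑ i, ‖(A *ᵥ v) i‖ ^ 2 ≤ ‖A‖ ^ 2 * ∑ i, ‖v i‖ ^ 2 := by
  have h := A.l2_opNorm_mulVec (WithLp.toLp 2 v)
  have h2 := pow_le_pow_left₀ (norm_nonneg _) h 2
  rw [mul_pow, EuclideanSpace.norm_sq_eq, EuclideanSpace.norm_sq_eq] at h2
  simpa using h2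

lemma norm_le_of_sum_sq_mulVec_le {A : Matrix ι ι ℂ} {c : ℝ} (hc : 0 ≤ c)
    (h : ∀ v : ι → ℂ, ∑ i, ‖(A *ᵥ v) i‖ ^ 2 ≤ c ^ 2 * ∑ i, ‖v i‖ ^ 2) : ‖A‖ ≤ c := by
  rw [cstar_norm_def]
  refine ContinuousLinearMap.opNorm_le_bound _ hc fun x => ?_
  refine le_of_sq_le_sq ?_ (by positivity)
  rw [mul_pow, EuclideanSpace.norm_sq_eq, EuclideanSpace.norm_sq_eq]
  simpa using h x.ofLp

lemma norm_submatrix_le (A : Matrix ι ι ℂ) (f : κ ↪ ι) : ‖A.submatrix f f‖ ≤ ‖A‖ := by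
  refine norm_le_of_sum_sq_mulVec_le (norm_nonneg _) fun v => ?_
  have key : ∀ g : ι → ℝ, (∀ i, i ∉ Set.range f → g i = 0) → ∑ i, g i = ∑ k, g (f k) :=
    fun g hg => by
      rw [← Finset.sum_map Finset.univ f g]
      refine (Finset.sum_subset (Finset.subset_univ _) fun i _ hi => hg i ?_).symm
      simpa using hi
  have hext : ∀ k, Function.extend f v 0 (f k) = v k := f.injective.extend_apply v 0
  have hext0 : ∀ i, i ∉ Set.range f → Function.extend f v 0 i = 0 := fun i hi =>
    Function.extend_apply' _ _ _ (by simpa using hi)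
  have h := sum_sq_mulVec_le A (Function.extend f v 0)
  rw [key (fun i => ‖Function.extend f v 0 i‖ ^ 2) fun i hi => by simp [hext0 i hi]] at h
  simp only [hext] at h
  refine le_trans ?_ h
  have hval : ∀ k, (A.submatrix f f *ᵥ v) k = (A *ᵥ Function.extend f v 0) (f k) := fun k => by
    simp only [mulVec, dotProduct, submatrix_apply]
    rw [← Finset.sum_subset (Finset.subset_univ (Finset.univ.map f)), Finset.sum_map]
    · simp only [hext]
    · intro i _ hi
      rw [hext0 i (by simpa using hi), mul_zero]
  simp only [hval]
  rw [← Finset.sum_map Finset.univ f (fun i => ‖(A *ᵥ Function.extend f v 0) i‖ ^ 2)]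
  exact Finset.sum_le_sum_of_subset_of_nonneg (Finset.subset_univ _) fun _ _ _ => by positivity

lemma norm_fromBlocks_diag_le (A : Matrix ι ι ℂ) (B : Matrix κ κ ℂ) :
    ‖fromBlocks A 0 0 B‖ ≤ max ‖A‖ ‖B‖ := by
  refine norm_le_of_sum_sq_mulVec_le (le_max_of_le_left (norm_nonneg _)) fun v => ?_
  have hA := sum_sq_mulVec_le A (v ∘ Sum.inl)
  have hB := sum_sq_mulVec_le B (v ∘ Sum.inr)
  have h1 : ‖A‖ ^ 2 ≤ max ‖A‖ ‖B‖ ^ 2 := by gcongr; exact le_max_left _ _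
  have h2 : ‖B‖ ^ 2 ≤ max ‖A‖ ‖B‖ ^ 2 := by gcongr; exact le_max_right _ _
  simp only [fromBlocks_mulVec, Fintype.sum_sum_type, Sum.elim_inl, Sum.elim_inr, zero_mulVec,
    add_zero, zero_add, mul_add]
  refine add_le_add (hA.trans ?_) (hB.trans ?_)
  · exact mul_le_mul_of_nonneg_right h1 (by positivity)
  · exact mul_le_mul_of_nonneg_right h2 (by positivity)

/-- The norm of a matrix that is block diagonal with respect to a splitting of its index set. -/
lemma norm_blockDiag (e : ι ⊕ κ ≃ μ) {A : Matrix ι ι ℂ} {B : Matrix κ κ ℂ} {M : Matrix μ μ ℂ}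
    (hM : M.submatrix e e = fromBlocks A 0 0 B) : ‖M‖ = max ‖A‖ ‖B‖ := by
  refine le_antisymm ?_ (max_le ?_ ?_)
  · have h := norm_submatrix_le (M.submatrix e e) e.symm.toEmbedding
    have : (M.submatrix e e).submatrix e.symm.toEmbedding e.symm.toEmbedding = M := by
      ext i j; simp
    rw [this, hM] at h
    exact h.trans (norm_fromBlocks_diag_le A B)
  · have h := norm_submatrix_le M (Function.Embedding.inl.trans e.toEmbedding)
    have : M.submatrix (Function.Embedding.inl.trans e.toEmbedding)
        (Function.Embedding.inl.trans e.toEmbedding) = A := by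
      ext i j; exact congrFun (congrFun hM (Sum.inl i)) (Sum.inl j)
    rwa [this] at h
  · have h := norm_submatrix_le M (Function.Embedding.inr.trans e.toEmbedding)
    have : M.submatrix (Function.Embedding.inr.trans e.toEmbedding)
        (Function.Embedding.inr.trans e.toEmbedding) = B := by
      ext i j; exact congrFun (congrFun hM (Sum.inr i)) (Sum.inr j)
    rwa [this] at h

/-- If `B` is upper Hessenberg for the grading `deg`, conjugating it by the dilation `r ^ deg`
increases its norm by a factor of at most `r`. -/
lemma norm_dilate_hessenberg_le (deg : ι → ℕ) (B : Matrix ι ι ℂ)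
    (hB : ∀ i j, deg j + 1 < deg i → B i j = 0) {r : ℝ} (hr : 1 ≤ r) :
    ‖(of fun i j => (r : ℂ) ^ deg i * B i j * ((r : ℂ) ^ deg j)⁻¹ : Matrix ι ι ℂ)‖ ≤ r * ‖B‖ := by
  have hr0 : 0 < r := by linarith
  let f : ℂ → Matrix ι ι ℂ := fun z => of fun i j => z ^ (deg j + 1 - deg i) * B i j
  have hf : ∀ z : ℂ, z ≠ 0 →
      f z = z • (diagonal (fun i => z⁻¹ ^ deg i) * B * diagonal (fun i => z ^ deg i)) := by
    intro z hz
    ext i j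
    simp only [f, of_apply, Matrix.smul_apply, mul_diagonal, diagonal_mul, smul_eq_mul]
    by_cases h : deg j + 1 < deg i
    · simp [hB i j h]
    · have : z ^ (deg j + 1) = z ^ (deg j + 1 - deg i) * z ^ deg i := by
        rw [← pow_add]; congr 1; omega
      have h2 : z ^ (deg j + 1 - deg i) = z * z⁻¹ ^ deg i * z ^ deg j := by
        rw [inv_pow]; field_simp; rw [← this]; ring
      rw [h2]; ring
  have hdiff : Differentiable ℂ f := by
    have : f = fun z => ∑ i, ∑ j, z ^ (deg j + 1 - deg i) • single i j (B i j) := by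
      funext z
      conv_lhs => rw [matrix_eq_sum_single (f z)]
      simp [f, smul_single]
    rw [this]
    fun_prop
  have hbound : ∀ z ∈ frontier (Metric.ball (0 : ℂ) 1), ‖f z‖ ≤ ‖B‖ := by
    intro z hz
    rw [frontier_ball _ one_ne_zero, mem_sphere_zero_iff_norm] at hz
    have hz0 : z ≠ 0 := by rintro rfl; simp at hz
    have hd : ∀ w : ℂ, ‖w‖ = 1 → ‖(diagonal fun i => w ^ deg i : Matrix ι ι ℂ)‖ ≤ 1 := by
      intro w hw
      rw [l2_opNorm_diagonal, pi_norm_le_iff_of_nonneg zero_le_one]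
      intro i; simp [hw]
    rw [hf z hz0, norm_smul, hz, one_mul]
    calc _ ≤ ‖(diagonal fun i => z⁻¹ ^ deg i : Matrix ι ι ℂ)‖ * ‖B‖
          * ‖(diagonal fun i => z ^ deg i : Matrix ι ι ℂ)‖ :=
          (norm_mul_le _ _).trans (by gcongr; exact norm_mul_le _ _)
      _ ≤ 1 * ‖B‖ * 1 := by gcongr; exacts [hd _ (by simp [hz]), hd _ hz]
      _ = ‖B‖ := by ring
  have hmax := Complex.norm_le_of_forall_mem_frontier_norm_le Metric.isBounded_ball
    hdiff.diffContOnCl hbound (z := ((r⁻¹ : ℝ) : ℂ)) (by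
      rw [closure_ball _ one_ne_zero, mem_closedBall_zero_iff, Complex.norm_real, norm_inv,
        Real.norm_of_nonneg hr0.le]
      exact inv_le_one_of_one_le₀ hr)
  have hrC : ((r⁻¹ : ℝ) : ℂ) ≠ 0 := by simpa using hr0.ne'
  rw [hf _ hrC, norm_smul, Complex.norm_real, norm_inv, Real.norm_of_nonneg hr0.le,
    inv_mul_le_iff₀ hr0] at hmax
  have heq : (of fun i j => (r : ℂ) ^ deg i * B i j * ((r : ℂ) ^ deg j)⁻¹ : Matrix ι ι ℂ) =
      diagonal (fun i => ((r⁻¹ : ℝ) : ℂ)⁻¹ ^ deg i) * B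
        * diagonal (fun i => ((r⁻¹ : ℝ) : ℂ) ^ deg i) := by
    ext i j
    simp [Matrix.mul_diagonal, Matrix.diagonal_mul]
  rwa [heq]

end MatrixNorm

/-- An orthonormal basis adapted to an increasing filtration by subspaces. -/
lemma exists_adapted_orthonormalBasis {n K : ℕ} (U : ℕ → Submodule ℂ (EuclideanSpace ℂ (Fin n)))
    (hU : Monotone U) (hK : U K = ⊤) :
    ∃ (b : OrthonormalBasis (Fin n) ℂ (EuclideanSpace ℂ (Fin n))) (deg : Fin n → ℕ),
      (∀ i, deg i ≤ K) ∧ (∀ i, b i ∈ U (deg i)) ∧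
      ∀ i, ∀ j < deg i, ∀ u ∈ U j, ⟪b i, u⟫_ℂ = 0 := by
  let V : Fin (K + 1) → Submodule ℂ (EuclideanSpace ℂ (Fin n)) := fun j =>
    U j ⊓ ⨅ i : ℕ, ⨅ _ : i < j, (U i)ᗮ
  have hVorth : ∀ (j : Fin (K + 1)) (v), v ∈ V j → ∀ i < (j : ℕ), v ∈ (U i)ᗮ := by
    intro j v hv i hi
    have := (Submodule.mem_inf.1 hv).2
    rw [Submodule.mem_iInf] at this
    have := this i
    rw [Submodule.mem_iInf] at this
    exact this hi
  have hV' : OrthogonalFamily ℂ (fun i => V i) fun i => (V i).subtypeₗᵢ := by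
    refine OrthogonalFamily.of_pairwise ?_
    have hlt : ∀ i j : Fin (K + 1), i < j → V i ⟂ V j := fun i j hij =>
      Submodule.isOrtho_iff_inner_eq.2 fun u hu v hv =>
        Submodule.inner_right_of_mem_orthogonal hu.1 (hVorth j v hv i hij)
    intro i j hij
    rcases lt_or_gt_of_ne hij with h | h
    · exact hlt i j h
    · exact (hlt j i h).symm
  have hsup : ∀ j : ℕ, j ≤ K → U j ≤ ⨆ i, V i := by
    intro j
    induction j with
    | zero =>
      intro _
      refine le_trans ?_ (le_iSup V 0)
      simp [V]
    | succ j ih =>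
      intro hj
      rw [← Submodule.sup_orthogonal_inf_of_hasOrthogonalProjection (hU (Nat.le_succ j))]
      refine sup_le (ih (by omega)) (le_trans ?_ (le_iSup V ⟨j + 1, by omega⟩))
      refine le_inf inf_le_right (inf_le_left.trans ?_)
      refine le_iInf fun i => le_iInf fun hi => Submodule.orthogonal_le (hU ?_)
      simpa [Nat.lt_succ_iff] using hi
  have hint : DirectSum.IsInternal V := by
    rw [hV'.isInternal_iff, ← le_bot_iff, ← Submodule.top_orthogonal_eq_bot, ← hK]
    exact Submodule.orthogonal_le (hsup K le_rfl)
  have hn : Module.finrank ℂ (EuclideanSpace ℂ (Fin n)) = n := by simp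
  have hmem := fun a => hint.subordinateOrthonormalBasis_subordinate hn a hV'
  refine ⟨hint.subordinateOrthonormalBasis hn hV',
    fun a => (hint.subordinateOrthonormalBasisIndex hn a hV' : Fin (K + 1)),
    fun i => Nat.lt_succ_iff.1 (Fin.is_lt _),
    fun i => (hmem i).1, fun i j hj u hu => ?_⟩
  exact Submodule.inner_left_of_mem_orthogonal hu (hVorth _ _ (hmem i) j hj)

/-- A linear functional on matrices that is contractive for the operator norm is a sum of vector
functionals of total mass at most one. -/
lemma exists_sum_inner_of_functional {n : ℕ} (l : Matrix (Fin n) (Fin n) ℂ →ₗ[ℂ] ℂ)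
    (hl : ∀ X, ‖l X‖ ≤ ‖X‖) :
    ∃ e f : Fin n → EuclideanSpace ℂ (Fin n), ∑ i, ‖e i‖ ^ 2 ≤ 1 ∧ ∑ i, ‖f i‖ ^ 2 ≤ 1 ∧
      ∀ X, l X = ∑ i, ⟪f i, toEuclideanCLM (𝕜 := ℂ) X (e i)⟫_ℂ := by
  let W : Matrix (Fin n) (Fin n) ℂ := of fun j i => l (single i j 1)
  have hlW : ∀ X, l X = (X * W).trace := by
    intro X
    conv_lhs => rw [matrix_eq_sum_single X]
    simp only [map_sum, trace, diag_apply, Matrix.mul_apply, W, of_apply]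
    refine Finset.sum_congr rfl fun i _ => Finset.sum_congr rfl fun j _ => ?_
    rw [← mul_one (X i j), ← smul_eq_mul, ← smul_single, map_smul]; simp
  let T := toEuclideanCLM (n := Fin n) (𝕜 := ℂ) W
  have hsymm : ((ContinuousLinearMap.adjoint T ∘L T : _ →L[ℂ] _) :
      EuclideanSpace ℂ (Fin n) →ₗ[ℂ] EuclideanSpace ℂ (Fin n)).IsSymmetric := fun x y => by
    simp [ContinuousLinearMap.adjoint_inner_left, ContinuousLinearMap.adjoint_inner_right]
  have hn : Module.finrank ℂ (EuclideanSpace ℂ (Fin n)) = n := by simp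
  let v := hsymm.eigenvectorBasis hn
  have hTv : ∀ i j, i ≠ j → ⟪T (v i), T (v j)⟫_ℂ = 0 := by
    intro i j hij
    have h := hsymm.apply_eigenvectorBasis hn j
    rw [ContinuousLinearMap.coe_coe, ContinuousLinearMap.comp_apply] at h
    rw [← ContinuousLinearMap.adjoint_inner_right, h, inner_smul_right,
      (hsymm.eigenvectorBasis hn).orthonormal.2 hij, mul_zero]
  let σ : Fin n → ℝ := fun i => ‖T (v i)‖
  have hσ : ∀ i, 0 ≤ σ i := fun i => norm_nonneg _
  have htr : ∀ X, l X = ∑ i, ⟪v i, toEuclideanCLM (𝕜 := ℂ) X (T (v i))⟫_ℂ := by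
    intro X
    have h := LinearMap.trace_eq_sum_inner
      (toEuclideanCLM (n := Fin n) (𝕜 := ℂ) (X * W)).toLinearMap v
    rw [hlW, ← Matrix.trace_toLin_eq (X * W) (EuclideanSpace.basisFun (Fin n) ℂ).toBasis]
    refine h.trans (Finset.sum_congr rfl fun i _ => ?_)
    rw [map_mul]; rfl
  let Y : EuclideanSpace ℂ (Fin n) →L[ℂ] EuclideanSpace ℂ (Fin n) :=
    ∑ i, ((σ i)⁻¹ : ℂ) • (innerSL ℂ (T (v i))).smulRight (v i)
  have hY : ∀ y, Y y = ∑ i, (((σ i)⁻¹ : ℂ) * ⟪T (v i), y⟫_ℂ) • v i := by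
    intro y
    simp [Y, mul_smul]
  have hYv : ∀ i y, ⟪v i, Y y⟫_ℂ = ((σ i)⁻¹ : ℂ) * ⟪T (v i), y⟫_ℂ := by
    intro i y
    rw [hY, v.orthonormal.inner_right_fintype]
  have hYnorm : ‖Y‖ ≤ 1 := by
    refine ContinuousLinearMap.opNorm_le_bound _ zero_le_one fun y => ?_
    rw [one_mul]
    refine le_of_sq_le_sq ?_ (norm_nonneg _)
    rw [← v.sum_sq_norm_inner_right]
    have hon : Orthonormal ℂ fun i : {i // σ i ≠ 0} => ((σ i)⁻¹ : ℂ) • T (v i) := by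
      refine ⟨fun i => ?_, fun i j hij => ?_⟩
      · rw [norm_smul, norm_inv, Complex.norm_real, Real.norm_of_nonneg (hσ i)]
        exact inv_mul_cancel₀ i.2
      · beta_reduce
        rw [inner_smul_left, inner_smul_right, hTv _ _ (Subtype.coe_injective.ne hij)]
        simp
    refine le_trans (le_of_eq ?_) (hon.sum_inner_products_le y (s := Finset.univ))
    rw [← Finset.sum_subtype (Finset.univ.filter (σ · ≠ 0)) (by simp)
      (fun i => ‖⟪((σ i)⁻¹ : ℂ) • T (v i), y⟫_ℂ‖ ^ 2), Finset.sum_filter_of_ne]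
    · refine Finset.sum_congr rfl fun i _ => ?_
      rw [hYv, inner_smul_left, map_inv₀, Complex.conj_ofReal]
    · intro i _ h h0
      simp [h0] at h
  have hsum : ∑ i, σ i ≤ 1 := by
    have h1 := hl ((toEuclideanCLM (n := Fin n) (𝕜 := ℂ)).symm Y)
    have h2 : l ((toEuclideanCLM (n := Fin n) (𝕜 := ℂ)).symm Y) = ((∑ i, σ i : ℝ) : ℂ) := by
      rw [htr, Complex.ofReal_sum]
      refine Finset.sum_congr rfl fun i _ => ?_
      rw [StarAlgEquiv.apply_symm_apply, hYv, inner_self_eq_norm_sq_to_K]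
      by_cases h : σ i = 0
      · simp [h]
      · change _ * ((σ i : ℂ)) ^ 2 = _
        have : (σ i : ℂ) ≠ 0 := by exact_mod_cast h
        field_simp
    rw [h2, Complex.norm_real, cstar_norm_def, StarAlgEquiv.apply_symm_apply] at h1
    exact (le_abs_self _).trans (h1.trans hYnorm)
  refine ⟨fun i => ((√(σ i))⁻¹ : ℂ) • T (v i), fun i => (√(σ i) : ℂ) • v i, ?_, ?_, fun X => ?_⟩
  · refine le_trans (le_of_eq (Finset.sum_congr rfl fun i _ => ?_)) hsum
    change _ = ‖T (v i)‖
    rw [norm_smul, mul_pow, norm_inv, Complex.norm_real, Real.norm_of_nonneg (Real.sqrt_nonneg _),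
      inv_pow, Real.sq_sqrt (hσ i), sq]
    by_cases h : σ i = 0
    · have h' : ‖T (v i)‖ = 0 := h
      simp [h']
    · exact inv_mul_cancel_left₀ h _
  · refine le_trans (le_of_eq (Finset.sum_congr rfl fun i _ => ?_)) hsum
    rw [norm_smul, mul_pow, Complex.norm_real, Real.norm_of_nonneg (Real.sqrt_nonneg _),
      Real.sq_sqrt (hσ i), v.orthonormal.1 i]
    simp
  · rw [htr]
    refine Finset.sum_congr rfl fun i _ => ?_
    rw [map_smul, inner_smul_left, inner_smul_right, Complex.conj_ofReal, ← mul_assoc]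
    by_cases h : σ i = 0
    · have h' : T (v i) = 0 := norm_eq_zero.1 h
      simp [h']
    · rw [mul_inv_cancel₀, one_mul]
      exact_mod_cast (Real.sqrt_pos.2 ((hσ i).lt_of_ne' h)).ne'

/-- A directed family of solvable approximation problems on a finite-dimensional space has a common
solution. -/
lemma exists_forall_norm_sub_le {I V : Type*} [Nonempty I] [AddCommGroup V] [Module ℂ V]
    [FiniteDimensional ℂ V] {E : I → Type*} [∀ i, NormedAddCommGroup (E i)]
    [∀ i, NormedSpace ℂ (E i)] (L : ∀ i, V →ₗ[ℂ] E i) (t : ∀ i, E i) (c : ℝ)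
    (hdir : ∀ i j, ∃ k, (∀ v, ‖L i v‖ ≤ ‖L k v‖) ∧
      (∀ v, ‖L i v - t i‖ ≤ ‖L k v - t k‖) ∧ (∀ v, ‖L j v‖ ≤ ‖L k v‖) ∧
      ∀ v, ‖L j v - t j‖ ≤ ‖L k v - t k‖)
    (hsol : ∀ i, ∃ v, ‖L i v - t i‖ ≤ c) : ∃ v, ∀ i, ‖L i v - t i‖ ≤ c := by
  obtain ⟨i₀, hi₀⟩ : ∃ i₀, ∀ i, LinearMap.ker (L i₀) ≤ LinearMap.ker (L i) := by
    let rk : I → ℕ := fun i => Module.finrank ℂ (LinearMap.ker (L i))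
    refine ⟨Function.argmin rk, fun i => ?_⟩
    obtain ⟨k, h1, -, h2, -⟩ := hdir (Function.argmin rk) i
    have hker : ∀ j, (∀ v, ‖L j v‖ ≤ ‖L k v‖) → LinearMap.ker (L k) ≤ LinearMap.ker (L j) := by
      intro j hj v hv
      have := hj v
      rw [LinearMap.mem_ker.1 hv, norm_zero] at this
      exact LinearMap.mem_ker.2 (norm_le_zero_iff.1 this)
    rw [← Submodule.eq_of_le_of_finrank_le (hker _ h1) (Function.argmin_le rk k)]
    exact hker i h2
  let R := LinearMap.range (L i₀)
  obtain ⟨s, hs⟩ := (L i₀).rangeRestrict.exists_rightInverse_of_surjective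
    (LinearMap.range_rangeRestrict _)
  have hsL : ∀ i v, L i (s ((L i₀).rangeRestrict v)) = L i v := by
    intro i v
    rw [← sub_eq_zero, ← map_sub]
    refine hi₀ i ?_
    rw [LinearMap.mem_ker, map_sub, sub_eq_zero]
    exact congrArg Subtype.val (LinearMap.congr_fun hs ((L i₀).rangeRestrict v))
  let S : I → Set R := fun i => {T | ‖L i (s T) - t i‖ ≤ c}
  have hcl : ∀ i, IsClosed (S i) := by
    intro i
    have : Continuous fun T => L i (s T) := ((L i).comp s).continuous_of_finiteDimensional
    exact isClosed_le (this.sub continuous_const).norm continuous_const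
  have hcpt : IsCompact (S i₀) := by
    have : ProperSpace R := FiniteDimensional.proper ℂ R
    refine Metric.isCompact_of_isClosed_isBounded (hcl i₀)
      (Metric.isBounded_closedBall (x := 0) (r := c + ‖t i₀‖) |>.subset fun T hT => ?_)
    have hT' : L i₀ (s T) = T := congrArg Subtype.val (LinearMap.congr_fun hs T)
    have h := norm_le_norm_sub_add (T : E i₀) (t i₀)
    rw [mem_closedBall_zero_iff]
    have hT2 : ‖L i₀ (s T) - t i₀‖ ≤ c := hT
    rw [hT'] at hT2
    exact h.trans (by gcongr)
  have hSsub : ∀ i k, (∀ v, ‖L i v - t i‖ ≤ ‖L k v - t k‖) → S k ⊆ S i :=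
    fun i k h T hT => (h _).trans hT
  have hSdir : Directed (· ⊇ ·) fun i => S i ∩ S i₀ := by
    intro i j
    obtain ⟨k, -, h1, -, h2⟩ := hdir i j
    exact ⟨k, Set.inter_subset_inter_left _ (hSsub i k h1),
      Set.inter_subset_inter_left _ (hSsub j k h2)⟩
  have hSne : ∀ i, (S i ∩ S i₀).Nonempty := by
    intro i
    obtain ⟨k, -, h1, -, h2⟩ := hdir i i₀
    obtain ⟨v, hv⟩ := hsol k
    have hmem : (L i₀).rangeRestrict v ∈ S k := by
      change ‖L k (s ((L i₀).rangeRestrict v)) - t k‖ ≤ c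
      rwa [hsL]
    exact ⟨_, hSsub i k h1 hmem, hSsub i₀ k h2 hmem⟩
  obtain ⟨T, hT⟩ := IsCompact.nonempty_iInter_of_directed_nonempty_isCompact_isClosed
    (fun i => S i ∩ S i₀) hSdir hSne (fun i => hcpt.inter_left (hcl i))
    (fun i => (hcl i).inter (hcl i₀))
  exact ⟨s T, fun i => (Set.mem_iInter.1 hT i).1⟩

section DirectSum

variable {d m n J : ℕ}

lemma mdsum_submatrix (A : Matrix (Fin m) (Fin m) ℂ) (B : Matrix (Fin n) (Fin n) ℂ) :
    (mdsum A B).submatrix finSumFinEquiv finSumFinEquiv = fromBlocks A 0 0 B := by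
  ext i j
  simp [mdsum]

lemma norm_mdsum (A : Matrix (Fin m) (Fin m) ℂ) (B : Matrix (Fin n) (Fin n) ℂ) :
    ‖mdsum A B‖ = max ‖A‖ ‖B‖ :=
  norm_blockDiag finSumFinEquiv (mdsum_submatrix A B)

lemma mdsum_add (A A' : Matrix (Fin m) (Fin m) ℂ) (B B' : Matrix (Fin n) (Fin n) ℂ) :
    mdsum A B + mdsum A' B' = mdsum (A + A') (B + B') := by
  ext i j
  refine Fin.addCases (fun i => ?_) (fun i => ?_) i <;>
    refine Fin.addCases (fun j => ?_) (fun j => ?_) j <;> simp [mdsum]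

lemma mdsum_sub (A A' : Matrix (Fin m) (Fin m) ℂ) (B B' : Matrix (Fin n) (Fin n) ℂ) :
    mdsum A B - mdsum A' B' = mdsum (A - A') (B - B') := by
  ext i j
  refine Fin.addCases (fun i => ?_) (fun i => ?_) i <;>
    refine Fin.addCases (fun j => ?_) (fun j => ?_) j <;> simp [mdsum]

lemma mdsum_mul (A A' : Matrix (Fin m) (Fin m) ℂ) (B B' : Matrix (Fin n) (Fin n) ℂ) :
    mdsum A B * mdsum A' B' = mdsum (A * A') (B * B') := by
  simp [mdsum, reindex_apply, submatrix_mul_equiv, fromBlocks_multiply]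

lemma mdsum_algebraMap (c : ℂ) :
    mdsum (algebraMap ℂ (Matrix (Fin m) (Fin m) ℂ) c) (algebraMap ℂ (Matrix (Fin n) (Fin n) ℂ) c)
      = algebraMap ℂ _ c := by
  simp only [mdsum, algebraMap_eq_diagonal, fromBlocks_diagonal, reindex_apply]
  rw [submatrix_diagonal_equiv]
  congr 1
  ext i
  refine Fin.addCases (fun i => ?_) (fun i => ?_) i <;> simp

lemma evalPoly_tdsum (p : FreeAlgebra ℂ (Fin d)) (x : MatTuple d m) (y : MatTuple d n) :
    evalPoly p (tdsum x y) = mdsum (evalPoly p x) (evalPoly p y) := by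
  simp only [evalPoly]
  induction p using FreeAlgebra.induction with
  | grade0 c => simp only [AlgHom.commutes, mdsum_algebraMap]
  | grade1 r => simp only [FreeAlgebra.lift_ι_apply, tdsum]
  | mul a b ha hb => simp only [map_mul, ha, hb, mdsum_mul]
  | add a b ha hb => simp only [map_add, ha, hb, mdsum_add]

lemma evalPoly_conj (p : FreeAlgebra ℂ (Fin d)) (x : MatTuple d n)
    {s : Matrix (Fin n) (Fin n) ℂ} (hs : IsUnit s) :
    evalPoly p (fun r => s⁻¹ * x r * s) = s⁻¹ * evalPoly p x * s := by
  have hdet := (isUnit_iff_isUnit_det s).1 hs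
  simp only [evalPoly]
  induction p using FreeAlgebra.induction with
  | grade0 c =>
    simp only [AlgHom.commutes]
    rw [mul_assoc, Algebra.commutes, ← mul_assoc, nonsing_inv_mul _ hdet, one_mul]
  | grade1 r => simp only [FreeAlgebra.lift_ι_apply]
  | mul a b ha hb =>
    simp only [map_mul, ha, hb]
    simp only [mul_assoc]
    rw [mul_nonsing_inv_cancel_left _ _ hdet]
  | add a b ha hb => simp only [map_add, ha, hb, mul_add, add_mul]

lemma norm_evalMat_tdsum (δ : Matrix (Fin J) (Fin J) (FreeAlgebra ℂ (Fin d)))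
    (x : MatTuple d m) (y : MatTuple d n) :
    ‖evalMat δ (tdsum x y)‖ = max ‖evalMat δ x‖ ‖evalMat δ y‖ := by
  refine norm_blockDiag ((Equiv.prodSumDistrib (Fin J) (Fin m) (Fin n)).symm.trans
    (Equiv.prodCongr (Equiv.refl _) finSumFinEquiv)) ?_
  ext (⟨a, i⟩ | ⟨a, i⟩) (⟨b, j⟩ | ⟨b, j⟩) <;>
    simp [evalMat, evalPoly_tdsum, mdsum]

lemma mem_Gdel_iff {δ : Matrix (Fin J) (Fin J) (FreeAlgebra ℂ (Fin d))} {x : MatTuple d n} :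
    x ∈ Gdel δ n ↔ ‖evalMat δ x‖ < 1 := Iff.rfl

lemma tdsum_mem_Gdel {δ : Matrix (Fin J) (Fin J) (FreeAlgebra ℂ (Fin d))} {x : MatTuple d m}
    {y : MatTuple d n} (hx : x ∈ Gdel δ m) (hy : y ∈ Gdel δ n) : tdsum x y ∈ Gdel δ (m + n) := by
  rw [mem_Gdel_iff, norm_evalMat_tdsum]
  exact max_lt hx hy

/-- The concatenation of two vectors. -/
def vappend (u : EuclideanSpace ℂ (Fin m)) (v : EuclideanSpace ℂ (Fin n)) :
    EuclideanSpace ℂ (Fin (m + n)) :=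
  WithLp.toLp 2 (Fin.append u v)

lemma norm_vappend_sq (u : EuclideanSpace ℂ (Fin m)) (v : EuclideanSpace ℂ (Fin n)) :
    ‖vappend u v‖ ^ 2 = ‖u‖ ^ 2 + ‖v‖ ^ 2 := by
  simp [EuclideanSpace.norm_sq_eq, vappend, Fin.sum_univ_add]

lemma mdsum_mulVec_append (A : Matrix (Fin m) (Fin m) ℂ) (B : Matrix (Fin n) (Fin n) ℂ)
    (u : Fin m → ℂ) (v : Fin n → ℂ) :
    mdsum A B *ᵥ Fin.append u v = Fin.append (A *ᵥ u) (B *ᵥ v) := by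
  ext i
  refine Fin.addCases (fun i => ?_) (fun i => ?_) i <;>
    simp [mulVec, dotProduct, Fin.sum_univ_add, mdsum]

lemma inner_vappend_mdsum (A : Matrix (Fin m) (Fin m) ℂ) (B : Matrix (Fin n) (Fin n) ℂ)
    (e f : EuclideanSpace ℂ (Fin m)) (e' f' : EuclideanSpace ℂ (Fin n)) :
    ⟪vappend f f', toEuclideanCLM (𝕜 := ℂ) (mdsum A B) (vappend e e')⟫_ℂ =
      ⟪f, toEuclideanCLM (𝕜 := ℂ) A e⟫_ℂ + ⟪f', toEuclideanCLM (𝕜 := ℂ) B e'⟫_ℂ := by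
  simp only [PiLp.inner_apply, vappend, toEuclideanCLM_toLp, mdsum_mulVec_append,
    Fin.sum_univ_add, Fin.append_left, Fin.append_right, ofLp_toEuclideanCLM]

/-- Sums of vector functionals at a point become a single vector functional at a direct sum of
copies of that point. -/
lemma exists_amplification {δ : Matrix (Fin J) (Fin J) (FreeAlgebra ℂ (Fin d))}
    {φ : ∀ n, MatTuple d n → Matrix (Fin n) (Fin n) ℂ} (hφ : IsNCFn (Gdel δ) φ)
    {x : MatTuple d n} (hx : x ∈ Gdel δ n) (N : ℕ) (e f : Fin N → EuclideanSpace ℂ (Fin n)) :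
    ∃ (m : ℕ) (y : MatTuple d m) (E F : EuclideanSpace ℂ (Fin m)),
      ‖evalMat δ y‖ ≤ ‖evalMat δ x‖ ∧ ‖E‖ ^ 2 = ∑ i, ‖e i‖ ^ 2 ∧ ‖F‖ ^ 2 = ∑ i, ‖f i‖ ^ 2 ∧
      (∀ p, ⟪F, toEuclideanCLM (𝕜 := ℂ) (evalPoly p y) E⟫_ℂ =
        ∑ i, ⟪f i, toEuclideanCLM (𝕜 := ℂ) (evalPoly p x) (e i)⟫_ℂ) ∧
      ⟪F, toEuclideanCLM (𝕜 := ℂ) (φ m y) E⟫_ℂ =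
        ∑ i, ⟪f i, toEuclideanCLM (𝕜 := ℂ) (φ n x) (e i)⟫_ℂ := by
  induction N with
  | zero =>
    refine ⟨0, fun _ => 0, 0, 0, ?_, by simp, by simp, by simp, by simp⟩
    rw [Subsingleton.elim (evalMat δ (fun _ => (0 : Matrix (Fin 0) (Fin 0) ℂ))) 0, norm_zero]
    exact norm_nonneg _
  | succ N ih =>
    obtain ⟨m, y, E, F, h1, h2, h3, h4, h5⟩ := ih (e ∘ Fin.castSucc) (f ∘ Fin.castSucc)
    have hy : y ∈ Gdel δ m := h1.trans_lt hx
    refine ⟨m + n, tdsum y x, vappend E (e (Fin.last N)), vappend F (f (Fin.last N)), ?_, ?_, ?_,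
      fun p => ?_, ?_⟩
    · rw [norm_evalMat_tdsum]
      exact max_le h1 le_rfl
    · rw [norm_vappend_sq, h2, Fin.sum_univ_castSucc]; rfl
    · rw [norm_vappend_sq, h3, Fin.sum_univ_castSucc]; rfl
    · rw [evalPoly_tdsum, inner_vappend_mdsum, h4, Fin.sum_univ_castSucc]; rfl
    · rw [hφ.map_dsum y x hy hx (tdsum_mem_Gdel hy hx), inner_vappend_mdsum, h5,
        Fin.sum_univ_castSucc]; rfl

end DirectSum

section Approximation

variable {d n J : ℕ}

/-- The matrix whose columns are the vectors of an orthonormal basis. -/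
noncomputable def basisMatrix (b : OrthonormalBasis (Fin n) ℂ (EuclideanSpace ℂ (Fin n))) :
    Matrix (Fin n) (Fin n) ℂ :=
  of fun i j => b j i

lemma conjTranspose_basisMatrix_mulVec
    (b : OrthonormalBasis (Fin n) ℂ (EuclideanSpace ℂ (Fin n))) (v : EuclideanSpace ℂ (Fin n))
    (i : Fin n) : ((basisMatrix b)ᴴ *ᵥ v.ofLp) i = ⟪b i, v⟫_ℂ := by
  simp [basisMatrix, mulVec, dotProduct, PiLp.inner_apply, mul_comm]

lemma conjTranspose_basisMatrix_mul_mul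
    (b : OrthonormalBasis (Fin n) ℂ (EuclideanSpace ℂ (Fin n))) (A : Matrix (Fin n) (Fin n) ℂ)
    (i j : Fin n) : ((basisMatrix b)ᴴ * A * basisMatrix b) i j =
      ⟪b i, toEuclideanCLM (𝕜 := ℂ) A (b j)⟫_ℂ := by
  rw [← conjTranspose_basisMatrix_mulVec, mul_assoc, ofLp_toEuclideanCLM]
  simp only [mul_apply, mulVec, dotProduct]
  rfl

lemma conjTranspose_basisMatrix_mul_self
    (b : OrthonormalBasis (Fin n) ℂ (EuclideanSpace ℂ (Fin n))) :
    (basisMatrix b)ᴴ * basisMatrix b = 1 := by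
  ext i j
  have h := conjTranspose_basisMatrix_mul_mul b 1 i j
  rw [mul_one, map_one, one_apply_eq_self,
    orthonormal_iff_ite.1 b.orthonormal i j] at h
  rw [h, one_apply]

lemma norm_le_one_of_conjTranspose_mul_self {ι : Type*} [Fintype ι] [DecidableEq ι]
    {U : Matrix ι ι ℂ} (hU : Uᴴ * U = 1) : ‖U‖ ≤ 1 := by
  refine norm_le_of_sum_sq_mulVec_le zero_le_one fun v => ?_
  have h : star (U *ᵥ v) ⬝ᵥ (U *ᵥ v) = star v ⬝ᵥ v := by
    rw [star_mulVec, dotProduct_mulVec, vecMul_vecMul, hU, vecMul_one]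
  simp only [dotProduct, Pi.star_apply, RCLike.star_def, RCLike.conj_mul] at h
  rw [one_pow, one_mul]
  exact le_of_eq (by exact_mod_cast h)

open scoped Kronecker in
lemma norm_blockwise_conj_le (B : Matrix (Fin J × Fin n) (Fin J × Fin n) ℂ)
    {Q : Matrix (Fin n) (Fin n) ℂ} (hQ : Qᴴ * Q = 1) :
    ‖(of fun a b => (Qᴴ * (of fun i j => B (a.1, i) (b.1, j)) * Q) a.2 b.2 :
      Matrix (Fin J × Fin n) (Fin J × Fin n) ℂ)‖ ≤ ‖B‖ := by
  have heq : (of fun a b => (Qᴴ * (of fun i j => B (a.1, i) (b.1, j)) * Q) a.2 b.2 :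
      Matrix (Fin J × Fin n) (Fin J × Fin n) ℂ) =
      ((1 : Matrix (Fin J) (Fin J) ℂ) ⊗ₖ Qᴴ) * B * ((1 : Matrix (Fin J) (Fin J) ℂ) ⊗ₖ Q) := by
    ext ⟨a, i⟩ ⟨b, j⟩
    simp [mul_apply, Fintype.sum_prod_type, one_apply]
  have hU : ((1 : Matrix (Fin J) (Fin J) ℂ) ⊗ₖ Q)ᴴ * ((1 : Matrix (Fin J) (Fin J) ℂ) ⊗ₖ Q) = 1 := by
    rw [conjTranspose_kronecker, ← mul_kronecker_mul, hQ, conjTranspose_one, one_mul,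
      one_kronecker_one]
  have h1 := norm_le_one_of_conjTranspose_mul_self hU
  have h2 : ‖(1 : Matrix (Fin J) (Fin J) ℂ) ⊗ₖ Qᴴ‖ ≤ 1 := by
    rw [← conjTranspose_one, ← conjTranspose_kronecker, l2_opNorm_conjTranspose]
    exact h1
  rw [heq]
  calc _ ≤ ‖(1 : Matrix (Fin J) (Fin J) ℂ) ⊗ₖ Qᴴ‖ * ‖B‖ * ‖(1 : Matrix (Fin J) (Fin J) ℂ) ⊗ₖ Q‖ :=
        (norm_mul_le _ _).trans (by gcongr; exact norm_mul_le _ _)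
    _ ≤ 1 * ‖B‖ * 1 := by gcongr
    _ = ‖B‖ := by ring

lemma monotone_submodule_pow {A : Type*} [Ring A] [Algebra ℂ A] {M : Submodule ℂ A}
    (hM : 1 ∈ M) : Monotone fun j : ℕ => M ^ j :=
  monotone_nat_of_le_succ fun j => by
    intro p hp
    rw [pow_succ, ← mul_one p]
    exact Submodule.mul_mem_mul hp hM

/-- If `φ` is a bounded nc-function on `G_δ` and `⟪f, p(x) e⟫` vanishes for all products `p` of at
most `k` entries of `δ`, then `⟪f, φ(x) e⟫` is small. -/
lemma norm_inner_le_of_forall_inner_eq_zero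
    {δ : Matrix (Fin J) (Fin J) (FreeAlgebra ℂ (Fin d))}
    {φ : ∀ n, MatTuple d n → Matrix (Fin n) (Fin n) ℂ} (hφ : IsNCFn (Gdel δ) φ)
    {C : ℝ} (hC : BddBy (Gdel δ) φ C)
    {M : Submodule ℂ (FreeAlgebra ℂ (Fin d))} (hM1 : 1 ∈ M) (hMδ : ∀ a b, δ a b ∈ M)
    {r : ℝ} (hr : 1 ≤ r) {x : MatTuple d n} (hx : r * ‖evalMat δ x‖ < 1) {k : ℕ}
    {e f : EuclideanSpace ℂ (Fin n)}
    (hef : ∀ p ∈ M ^ k, ⟪f, toEuclideanCLM (𝕜 := ℂ) (evalPoly p x) e⟫_ℂ = 0) :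
    ‖⟪f, toEuclideanCLM (𝕜 := ℂ) (φ n x) e⟫_ℂ‖ ≤ C * (r ^ (k + 1))⁻¹ * ‖e‖ * ‖f‖ := by
  have hr0 : 0 < r := by linarith
  have hxG : x ∈ Gdel δ n := by
    rw [mem_Gdel_iff]
    nlinarith [norm_nonneg (evalMat δ x)]
  have hMmono : Monotone fun j => M ^ j := monotone_submodule_pow hM1
  let ev : FreeAlgebra ℂ (Fin d) →ₗ[ℂ] EuclideanSpace ℂ (Fin n) :=
    { toFun := fun p => toEuclideanCLM (𝕜 := ℂ) (evalPoly p x) e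
      map_add' := fun p q => by simp [evalPoly]
      map_smul' := fun c p => by simp [evalPoly] }
  let U : ℕ → Submodule ℂ (EuclideanSpace ℂ (Fin n)) := fun j =>
    if j ≤ k then (M ^ j).map ev else ⊤
  have hU : Monotone U := by
    intro i j hij
    by_cases hj : j ≤ k
    · simp only [U, hj, hij.trans hj, if_true]
      exact Submodule.map_mono (hMmono hij)
    · simp [U, hj]
  obtain ⟨b, deg, hdegK, hbU, hbperp⟩ :=
    exists_adapted_orthonormalBasis (K := k + 1) U hU (by simp [U])
  have he0 : e ∈ U 0 := by
    simp only [U, zero_le, if_true, pow_zero]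
    exact ⟨1, Submodule.one_le.1 le_rfl, by simp [ev, evalPoly]⟩
  have hbe : ∀ i, deg i ≠ 0 → ⟪b i, e⟫_ℂ = 0 := fun i hi =>
    hbperp i 0 (Nat.pos_of_ne_zero hi) e he0
  have hbf : ∀ i, deg i ≠ k + 1 → ⟪b i, f⟫_ℂ = 0 := by
    intro i hi
    have hik : deg i ≤ k := by have := hdegK i; omega
    have hb := hbU i
    simp only [U, hik, if_true] at hb
    obtain ⟨p, hp, hpb⟩ := hb
    rw [← inner_conj_symm, ← hpb]
    exact (congrArg _ (hef p (hMmono hik hp))).trans (map_zero _)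
  have hess : ∀ a c i j, deg j + 1 < deg i →
      ⟪b i, toEuclideanCLM (𝕜 := ℂ) (evalPoly (δ a c) x) (b j)⟫_ℂ = 0 := by
    intro a c i j hij
    refine hbperp i (deg j + 1) hij _ ?_
    have hjk : deg j + 1 ≤ k := by have := hdegK i; omega
    have hb := hbU j
    simp only [U, (Nat.le_succ _).trans hjk, hjk, if_true] at hb ⊢
    obtain ⟨p, hp, hpb⟩ := hb
    refine ⟨δ a c * p, ?_, ?_⟩
    · rw [pow_succ']
      exact Submodule.mul_mem_mul (hMδ a c) hp
    · rw [← hpb]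
      simp [ev, evalPoly]
  let Q := basisMatrix b
  have hQ : Qᴴ * Q = 1 := conjTranspose_basisMatrix_mul_self b
  have hQ' : Q * Qᴴ = 1 := mul_eq_one_comm.1 hQ
  have hrC : (r : ℂ) ≠ 0 := by exact_mod_cast hr0.ne'
  let s : Matrix (Fin n) (Fin n) ℂ := Q * diagonal fun i => ((r : ℂ) ^ deg i)⁻¹
  let t : Matrix (Fin n) (Fin n) ℂ := (diagonal fun i => (r : ℂ) ^ deg i) * Qᴴ
  have hst : s * t = 1 := by
    have : (diagonal fun i => ((r : ℂ) ^ deg i)⁻¹) * (diagonal fun i => (r : ℂ) ^ deg i)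
        = (1 : Matrix (Fin n) (Fin n) ℂ) := by
      rw [diagonal_mul_diagonal, ← diagonal_one]
      congr 1; funext i
      exact inv_mul_cancel₀ (pow_ne_zero _ hrC)
    calc s * t = Q * ((diagonal fun i => ((r : ℂ) ^ deg i)⁻¹) *
          (diagonal fun i => (r : ℂ) ^ deg i)) * Qᴴ := by simp only [s, t, mul_assoc]
      _ = 1 := by rw [this, mul_one, hQ']
  have hs : IsUnit s := IsUnit.of_mul_eq_one t hst
  have hinv : s⁻¹ = t := inv_eq_right_inv hst
  have hconj : ∀ (A : Matrix (Fin n) (Fin n) ℂ) i j,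
      (s⁻¹ * A * s) i j = (r : ℂ) ^ deg i * (Qᴴ * A * Q) i j * ((r : ℂ) ^ deg j)⁻¹ := by
    intro A i j
    have : s⁻¹ * A * s = (diagonal fun i => (r : ℂ) ^ deg i) * (Qᴴ * A * Q) *
        (diagonal fun i => ((r : ℂ) ^ deg i)⁻¹) := by
      rw [hinv]; simp only [s, t, mul_assoc]
    rw [this, mul_diagonal, diagonal_mul]
  let y : MatTuple d n := fun l => s⁻¹ * x l * s
  have hy : y ∈ Gdel δ n := by
    rw [mem_Gdel_iff]
    refine lt_of_le_of_lt ?_ hx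
    have h1 := norm_blockwise_conj_le (evalMat δ x) hQ
    have h2 := norm_dilate_hessenberg_le (fun a : Fin J × Fin n => deg a.2)
      (of fun a b => (Qᴴ * (of fun i j => evalMat δ x (a.1, i) (b.1, j)) * Q) a.2 b.2)
      (fun a c hac => by
        rw [of_apply, conjTranspose_basisMatrix_mul_mul]
        exact hess a.1 c.1 a.2 c.2 hac) hr
    have h3 : evalMat δ y = of fun a c => (r : ℂ) ^ deg a.2 *
        (of fun a b => (Qᴴ * (of fun i j => evalMat δ x (a.1, i) (b.1, j)) * Q) a.2 b.2) a c
          * ((r : ℂ) ^ deg c.2)⁻¹ := by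
      ext a c
      simp only [evalMat, y]
      rw [evalPoly_conj _ _ hs, hconj]
      rfl
    rw [h3]
    exact h2.trans (by gcongr)
  have hφy : φ n y = s⁻¹ * φ n x * s := hφ.map_sim x s hs hxG hy
  have hφx : φ n x = s * φ n y * t := by
    have hts : t * s = 1 := mul_eq_one_comm.1 hst
    rw [hφy, hinv]
    calc φ n x = (s * t) * φ n x * (s * t) := by rw [hst, one_mul, mul_one]
      _ = s * (t * φ n x * s) * t := by simp only [mul_assoc]
  have hte : ‖toEuclideanCLM (𝕜 := ℂ) t e‖ = ‖e‖ := by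
    refine (sq_eq_sq₀ (norm_nonneg _) (norm_nonneg _)).1 ?_
    rw [← b.sum_sq_norm_inner_right e, EuclideanSpace.norm_sq_eq]
    refine Finset.sum_congr rfl fun i _ => ?_
    rw [ofLp_toEuclideanCLM, ← mulVec_mulVec, mulVec_diagonal, conjTranspose_basisMatrix_mulVec]
    by_cases hi : deg i = 0
    · simp [hi]
    · simp [hbe i hi]
  have hsf : ‖toEuclideanCLM (𝕜 := ℂ) sᴴ f‖ = (r ^ (k + 1))⁻¹ * ‖f‖ := by
    refine (sq_eq_sq₀ (norm_nonneg _) (by positivity)).1 ?_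
    rw [mul_pow, ← b.sum_sq_norm_inner_right f, EuclideanSpace.norm_sq_eq, Finset.mul_sum]
    refine Finset.sum_congr rfl fun i _ => ?_
    rw [ofLp_toEuclideanCLM, conjTranspose_mul, ← mulVec_mulVec, diagonal_conjTranspose,
      mulVec_diagonal, conjTranspose_basisMatrix_mulVec, norm_mul, mul_pow]
    by_cases hi : deg i = k + 1
    · simp [hi, abs_of_pos hr0]
    · simp [hbf i hi]
  have hinner : ⟪f, toEuclideanCLM (𝕜 := ℂ) (φ n x) e⟫_ℂ =
      ⟪toEuclideanCLM (𝕜 := ℂ) sᴴ f, toEuclideanCLM (𝕜 := ℂ) (φ n y)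
        (toEuclideanCLM (𝕜 := ℂ) t e)⟫_ℂ := by
    rw [hφx, map_mul, map_mul, ← star_eq_conjTranspose, map_star,
      ContinuousLinearMap.star_eq_adjoint, ContinuousLinearMap.adjoint_inner_left]
    rfl
  rw [hinner]
  calc _ ≤ ‖toEuclideanCLM (𝕜 := ℂ) sᴴ f‖ * (‖toEuclideanCLM (𝕜 := ℂ) (φ n y)‖ *
        ‖toEuclideanCLM (𝕜 := ℂ) t e‖) :=
        (norm_inner_le_norm _ _).trans (by gcongr; exact ContinuousLinearMap.le_opNorm _ _)
    _ ≤ ((r ^ (k + 1))⁻¹ * ‖f‖) * (C * ‖e‖) := by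
        rw [hsf, hte]
        gcongr
        exact hC n y hy
    _ = C * (r ^ (k + 1))⁻¹ * ‖e‖ * ‖f‖ := by ring

end Approximation

section UniformApproximation

variable {d n J : ℕ}

lemma nonneg_of_bddBy {δ : Matrix (Fin J) (Fin J) (FreeAlgebra ℂ (Fin d))}
    {φ : ∀ n, MatTuple d n → Matrix (Fin n) (Fin n) ℂ} {C : ℝ} (hC : BddBy (Gdel δ) φ C)
    {x : MatTuple d n} (hx : x ∈ Gdel δ n) : 0 ≤ C :=
  (norm_nonneg _).trans (hC n x hx)

/-- Approximation of a bounded nc-function at a single point of a smaller polynomial polyhedron by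
a polynomial of controlled degree in the entries of `δ`. -/
lemma exists_norm_evalPoly_sub_le
    {δ : Matrix (Fin J) (Fin J) (FreeAlgebra ℂ (Fin d))}
    {φ : ∀ n, MatTuple d n → Matrix (Fin n) (Fin n) ℂ} (hφ : IsNCFn (Gdel δ) φ)
    {C : ℝ} (hC : BddBy (Gdel δ) φ C)
    {M : Submodule ℂ (FreeAlgebra ℂ (Fin d))} (hM1 : 1 ∈ M) (hMδ : ∀ a b, δ a b ∈ M)
    {r : ℝ} (hr : 1 ≤ r) {x : MatTuple d n} (hx : r * ‖evalMat δ x‖ < 1) {k : ℕ}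
    {c : ℝ} (hc : C * (r ^ (k + 1))⁻¹ < c) :
    ∃ p ∈ M ^ k, ‖evalPoly p x - φ n x‖ ≤ c := by
  have hr0 : 0 < r := by linarith
  have hxG : x ∈ Gdel δ n := by
    rw [mem_Gdel_iff]
    nlinarith [norm_nonneg (evalMat δ x)]
  have hC0 := nonneg_of_bddBy hC hxG
  let S : Submodule ℂ (Matrix (Fin n) (Fin n) ℂ) :=
    (M ^ k).map (FreeAlgebra.lift ℂ x).toLinearMap
  have hclosed : IsClosed (S : Set (Matrix (Fin n) (Fin n) ℂ)) := S.closed_of_finiteDimensional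
  obtain ⟨g, hg1, hg⟩ := exists_dual_vector'' ℂ (S.mkQ (φ n x))
  have hgle : ∀ X, ‖g (S.mkQ X)‖ ≤ ‖X‖ := fun X =>
    calc _ ≤ ‖g‖ * ‖S.mkQ X‖ := g.le_opNorm _
      _ ≤ 1 * ‖X‖ := by gcongr; exact Submodule.Quotient.norm_mk_le S X
      _ = ‖X‖ := one_mul _
  obtain ⟨e, f, he, hf, hl⟩ :=
    exists_sum_inner_of_functional (g.toLinearMap ∘ₗ S.mkQ) hgle
  obtain ⟨m, y, E, F, hy, hE, hF, hp, hφy⟩ := exists_amplification hφ hxG n e f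
  have hE1 : ‖E‖ ≤ 1 := by
    rw [← sq_le_one_iff₀ (norm_nonneg _), hE]; exact he
  have hF1 : ‖F‖ ≤ 1 := by
    rw [← sq_le_one_iff₀ (norm_nonneg _), hF]; exact hf
  have hkey := norm_inner_le_of_forall_inner_eq_zero hφ hC hM1 hMδ hr
    (lt_of_le_of_lt (by gcongr) hx) (k := k) (e := E) (f := F) (x := y) fun p hpM => by
      rw [hp, ← hl]
      have : S.mkQ (evalPoly p x) = 0 := by
        rw [Submodule.mkQ_apply, Submodule.Quotient.mk_eq_zero]
        exact ⟨p, hpM, rfl⟩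
      rw [LinearMap.comp_apply, this, map_zero]
  have hφl : ‖S.mkQ (φ n x)‖ < c := by
    refine lt_of_le_of_lt ?_ hc
    rw [hφy, ← hl] at hkey
    have h1 : ‖(g.toLinearMap ∘ₗ S.mkQ) (φ n x)‖ = ‖S.mkQ (φ n x)‖ := by
      change ‖g (S.mkQ (φ n x))‖ = _
      rw [hg]; simp
    rw [h1] at hkey
    calc _ ≤ C * (r ^ (k + 1))⁻¹ * ‖E‖ * ‖F‖ := hkey
      _ ≤ C * (r ^ (k + 1))⁻¹ * 1 * 1 := by gcongr
      _ = _ := by ring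
  obtain ⟨X, hX, hXc⟩ := QuotientAddGroup.norm_lt_iff.1 hφl
  have hmem : φ n x - X ∈ S := by
    rw [← Submodule.Quotient.eq]
    exact hX.symm
  obtain ⟨p, hpM, hpX⟩ := hmem
  refine ⟨p, hpM, ?_⟩
  have : evalPoly p x - φ n x = -X := by
    have : evalPoly p x = φ n x - X := hpX
    rw [this]; abel
  rw [this, norm_neg]
  exact hXc.le

/-- Uniform approximation of a bounded nc-function by polynomials on a smaller polynomial
polyhedron. -/
lemma exists_forall_norm_evalPoly_sub_le
    {δ : Matrix (Fin J) (Fin J) (FreeAlgebra ℂ (Fin d))}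
    {φ : ∀ n, MatTuple d n → Matrix (Fin n) (Fin n) ℂ} (hφ : IsNCFn (Gdel δ) φ)
    {C : ℝ} (hC : BddBy (Gdel δ) φ C) {r : ℝ} (hr : 1 ≤ r) {k : ℕ} {c : ℝ}
    (hc : C * (r ^ (k + 1))⁻¹ < c) :
    ∃ p : FreeAlgebra ℂ (Fin d), ∀ n, ∀ x : MatTuple d n, r * ‖evalMat δ x‖ < 1 →
      ‖evalPoly p x - φ n x‖ ≤ c := by
  let M : Submodule ℂ (FreeAlgebra ℂ (Fin d)) :=
    Submodule.span ℂ (insert 1 (Set.range fun a : Fin J × Fin J => δ a.1 a.2))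
  have hM1 : 1 ∈ M := Submodule.subset_span (Set.mem_insert _ _)
  have hMδ : ∀ a b, δ a b ∈ M := fun a b =>
    Submodule.subset_span (Set.mem_insert_of_mem _ ⟨(a, b), rfl⟩)
  have hMfg : (M ^ k).FG :=
    (Submodule.fg_span ((Set.finite_range _).insert _)).pow k
  have : FiniteDimensional ℂ ↥(M ^ k) := Module.Finite.iff_fg.2 hMfg
  let I := Σ n, {x : MatTuple d n // r * ‖evalMat δ x‖ < 1}
  have hr0 : 0 < r := by linarith
  have hG : ∀ {n} {x : MatTuple d n}, r * ‖evalMat δ x‖ < 1 → x ∈ Gdel δ n := by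
    intro n x hx
    rw [mem_Gdel_iff]
    nlinarith [norm_nonneg (evalMat δ x)]
  have : Nonempty I := ⟨⟨0, fun _ => 0, by
    rw [Subsingleton.elim (evalMat δ (fun _ => (0 : Matrix (Fin 0) (Fin 0) ℂ))) 0]
    simp⟩⟩
  obtain ⟨p, hp⟩ := exists_forall_norm_sub_le (I := I) (V := ↥(M ^ k))
    (fun i => (FreeAlgebra.lift ℂ i.2.1).toLinearMap ∘ₗ (M ^ k).subtype)
    (fun i => φ i.1 i.2.1) c
    (by
      rintro ⟨m, x, hx⟩ ⟨n, y, hy⟩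
      have hxy : r * ‖evalMat δ (tdsum x y)‖ < 1 := by
        rw [norm_evalMat_tdsum, mul_max_of_nonneg _ _ hr0.le]
        exact max_lt hx hy
      have hsum := hφ.map_dsum x y (hG hx) (hG hy) (hG hxy)
      have h1 : ∀ v : ↥(M ^ k), ‖evalPoly v.1 (tdsum x y)‖ =
          max ‖evalPoly v.1 x‖ ‖evalPoly v.1 y‖ := fun v => by
        rw [evalPoly_tdsum, norm_mdsum]
      have h2 : ∀ v : ↥(M ^ k), ‖evalPoly v.1 (tdsum x y) - φ (m + n) (tdsum x y)‖ =
          max ‖evalPoly v.1 x - φ m x‖ ‖evalPoly v.1 y - φ n y‖ := fun v => by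
        rw [hsum, evalPoly_tdsum, mdsum_sub, norm_mdsum]
      exact ⟨⟨m + n, tdsum x y, hxy⟩, fun v => (le_max_left _ _).trans_eq (h1 v).symm,
        fun v => (le_max_left _ _).trans_eq (h2 v).symm,
        fun v => (le_max_right _ _).trans_eq (h1 v).symm,
        fun v => (le_max_right _ _).trans_eq (h2 v).symm⟩)
    (by
      rintro ⟨n, x, hx⟩
      obtain ⟨p, hpM, hp⟩ := exists_norm_evalPoly_sub_le hφ hC hM1 hMδ hr hx hc
      exact ⟨⟨p, hpM⟩, hp⟩)
  exact ⟨p.1, fun n x hx => hp ⟨n, x, hx⟩⟩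

lemma norm_evalMat_smul (δ : Matrix (Fin J) (Fin J) (FreeAlgebra ℂ (Fin d))) (x : MatTuple d n)
    {r : ℝ} (hr : 0 ≤ r) : ‖evalMat ((r : ℂ) • δ) x‖ = r * ‖evalMat δ x‖ := by
  have : evalMat ((r : ℂ) • δ) x = (r : ℂ) • evalMat δ x := by
    ext a b
    exact congrFun (congrFun (map_smul (FreeAlgebra.lift ℂ x) (r : ℂ) (δ a.1 b.1)) a.2) b.2
  rw [this, norm_smul, Complex.norm_real, Real.norm_of_nonneg hr]

/-- A bounded nc-function on `G_δ` is, near every point, a uniform limit of polynomials. -/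
lemma exists_uniform_approximation
    {δ : Matrix (Fin J) (Fin J) (FreeAlgebra ℂ (Fin d))}
    {φ : ∀ n, MatTuple d n → Matrix (Fin n) (Fin n) ℂ} (hφ : IsNCFn (Gdel δ) φ)
    {C : ℝ} (hC : BddBy (Gdel δ) φ C) {x : MatTuple d n} (hx : x ∈ Gdel δ n) :
    ∃ δ' : Matrix (Fin J) (Fin J) (FreeAlgebra ℂ (Fin d)), x ∈ Gdel δ' n ∧
      (∀ m, Gdel δ' m ⊆ Gdel δ m) ∧ ∃ p : ℕ → FreeAlgebra ℂ (Fin d),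
        ∀ ε : ℝ, 0 < ε → ∃ k₀ : ℕ, ∀ k ≥ k₀, ∀ m, ∀ y ∈ Gdel δ' m,
          ‖evalPoly (p k) y - φ m y‖ ≤ ε := by
  rw [mem_Gdel_iff] at hx
  obtain ⟨r, hr1, hrx⟩ : ∃ r : ℝ, 1 < r ∧ r * ‖evalMat δ x‖ < 1 := by
    have h0 := norm_nonneg (evalMat δ x)
    refine ⟨2 / (1 + ‖evalMat δ x‖), ?_, ?_⟩
    · rw [lt_div_iff₀ (by positivity)]; linarith
    · rw [div_mul_eq_mul_div, div_lt_one (by positivity)]; linarith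
  have hr0 : 0 < r := by linarith
  have hmem : ∀ {m} {y : MatTuple d m}, y ∈ Gdel ((r : ℂ) • δ) m ↔ r * ‖evalMat δ y‖ < 1 := by
    intro m y
    rw [mem_Gdel_iff, norm_evalMat_smul δ y hr0.le]
  have hp : ∀ k : ℕ, ∃ p : FreeAlgebra ℂ (Fin d), ∀ n, ∀ x : MatTuple d n,
      r * ‖evalMat δ x‖ < 1 → ‖evalPoly p x - φ n x‖ ≤ (C + 1) * (r ^ (k + 1))⁻¹ := fun k =>
    exists_forall_norm_evalPoly_sub_le hφ hC hr1.le
      (mul_lt_mul_of_pos_right (lt_add_one C) (by positivity))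
  choose p hp using hp
  refine ⟨(r : ℂ) • δ, hmem.2 hrx, fun m y hy => ?_, p, fun ε hε => ?_⟩
  · rw [hmem] at hy
    rw [mem_Gdel_iff]
    nlinarith [norm_nonneg (evalMat δ y)]
  · have hlim : Filter.Tendsto (fun k : ℕ => (C + 1) * (r ^ (k + 1))⁻¹) Filter.atTop (nhds 0) := by
      have h := (tendsto_pow_atTop_nhds_zero_of_lt_one (inv_nonneg.2 hr0.le)
        (inv_lt_one_of_one_lt₀ hr1)).comp (Filter.tendsto_add_atTop_nat 1)
      simpa [Function.comp_def] using h.const_mul (C + 1)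
    obtain ⟨k₀, hk₀⟩ := Filter.eventually_atTop.1 (hlim.eventually_le_const hε)
    exact ⟨k₀, fun k hk m y hy => (hp k m y (hmem.1 hy)).trans (hk₀ k hk)⟩

end UniformApproximation

section Converse

variable {d n J : ℕ}

/-- The defining matrix of the intersection of `G_δ` with `{x : ‖p(x)‖ < 1}`. -/
def adjoinPoly (δ : Matrix (Fin J) (Fin J) (FreeAlgebra ℂ (Fin d)))
    (p : FreeAlgebra ℂ (Fin d)) :
    Matrix (Fin (J + 1)) (Fin (J + 1)) (FreeAlgebra ℂ (Fin d)) :=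
  reindex finSumFinEquiv finSumFinEquiv (fromBlocks δ 0 0 (of fun _ _ : Fin 1 => p))

lemma norm_evalMat_adjoinPoly (δ : Matrix (Fin J) (Fin J) (FreeAlgebra ℂ (Fin d)))
    (p : FreeAlgebra ℂ (Fin d)) (x : MatTuple d n) :
    ‖evalMat (adjoinPoly δ p) x‖ = max ‖evalMat δ x‖ ‖evalPoly p x‖ := by
  refine norm_blockDiag
    ((Equiv.sumCongr (Equiv.refl _) (Equiv.uniqueProd (Fin n) (Fin 1)).symm).trans
    ((Equiv.sumProdDistrib (Fin J) (Fin 1) (Fin n)).symm.trans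
    (Equiv.prodCongr finSumFinEquiv (Equiv.refl _)))) ?_
  ext (⟨a, i⟩ | i) (⟨b, j⟩ | j) <;>
    simp [evalMat, adjoinPoly, evalPoly]

lemma eq_of_forall_norm_sub_le {A B : Matrix (Fin n) (Fin n) ℂ}
    (h : ∀ ε > 0, ‖A - B‖ ≤ ε) : A = B :=
  sub_eq_zero.1 (norm_le_zero_iff.1 (le_of_forall_pos_le_add fun ε hε => by simpa using h ε hε))

/-- A uniform limit of polynomials on `G_δ` is an nc-function. -/
lemma isNCFn_of_uniform_approximation
    {δ : Matrix (Fin J) (Fin J) (FreeAlgebra ℂ (Fin d))}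
    {φ : ∀ n, MatTuple d n → Matrix (Fin n) (Fin n) ℂ}
    (h : ∀ ε : ℝ, 0 < ε → ∃ p : FreeAlgebra ℂ (Fin d), ∀ m, ∀ y ∈ Gdel δ m,
      ‖evalPoly p y - φ m y‖ ≤ ε) : IsNCFn (Gdel δ) φ where
  map_dsum {m n} x y hx hy hxy := by
    refine eq_of_forall_norm_sub_le fun ε hε => ?_
    obtain ⟨p, hp⟩ := h (ε / 2) (by positivity)
    have heq : φ (m + n) (tdsum x y) - mdsum (φ m x) (φ n y) =
        mdsum (evalPoly p x - φ m x) (evalPoly p y - φ n y) -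
          (evalPoly p (tdsum x y) - φ (m + n) (tdsum x y)) := by
      rw [← mdsum_sub, evalPoly_tdsum]; abel
    have h1 : ‖mdsum (evalPoly p x - φ m x) (evalPoly p y - φ n y)‖ ≤ ε / 2 := by
      rw [norm_mdsum]
      exact max_le (hp _ _ hx) (hp _ _ hy)
    rw [heq]
    linarith [norm_sub_le (mdsum (evalPoly p x - φ m x) (evalPoly p y - φ n y))
      (evalPoly p (tdsum x y) - φ (m + n) (tdsum x y)), hp _ _ hxy]
  map_sim {n} x s hs hx hsx := by
    refine eq_of_forall_norm_sub_le fun ε hε => ?_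
    have hK : 0 < 1 + ‖s⁻¹‖ * ‖s‖ := by positivity
    obtain ⟨p, hp⟩ := h (ε / (1 + ‖s⁻¹‖ * ‖s‖)) (by positivity)
    set y : MatTuple d n := fun r => s⁻¹ * x r * s with hy
    have heq : φ n y - s⁻¹ * φ n x * s =
        s⁻¹ * (evalPoly p x - φ n x) * s - (evalPoly p y - φ n y) := by
      rw [hy, evalPoly_conj p x hs, mul_sub, sub_mul]; abel
    rw [heq]
    calc _ ≤ ‖s⁻¹ * (evalPoly p x - φ n x) * s‖ + ‖evalPoly p y - φ n y‖ := norm_sub_le _ _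
      _ ≤ ‖s⁻¹‖ * (ε / (1 + ‖s⁻¹‖ * ‖s‖)) * ‖s‖ + ε / (1 + ‖s⁻¹‖ * ‖s‖) := by
          refine add_le_add ?_ (hp _ _ hsx)
          refine (norm_mul_le _ _).trans ?_
          gcongr
          refine (norm_mul_le _ _).trans ?_
          gcongr
          exact hp _ _ hx
      _ = ε := by field_simp; ring

/-- Near every point of `G_δ`, a uniform limit of polynomials on `G_δ` is a bounded nc-function. -/
lemma exists_bounded_of_uniform_approximation
    {δ : Matrix (Fin J) (Fin J) (FreeAlgebra ℂ (Fin d))}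
    {φ : ∀ n, MatTuple d n → Matrix (Fin n) (Fin n) ℂ}
    (h : ∀ ε : ℝ, 0 < ε → ∃ p : FreeAlgebra ℂ (Fin d), ∀ m, ∀ y ∈ Gdel δ m,
      ‖evalPoly p y - φ m y‖ ≤ ε) {x : MatTuple d n} (hx : x ∈ Gdel δ n) :
    ∃ δ' : Matrix (Fin (J + 1)) (Fin (J + 1)) (FreeAlgebra ℂ (Fin d)), x ∈ Gdel δ' n ∧
      (∀ m, Gdel δ' m ⊆ Gdel δ m) ∧ IsNCFn (Gdel δ') φ ∧ ∃ C, BddBy (Gdel δ') φ C := by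
  obtain ⟨p, hp⟩ := h 1 one_pos
  have hK : 0 < 1 + ‖evalPoly p x‖ := by positivity
  let q : FreeAlgebra ℂ (Fin d) := (((1 + ‖evalPoly p x‖)⁻¹ : ℝ) : ℂ) • p
  have hq : ∀ {m} (y : MatTuple d m),
      ‖evalPoly q y‖ = (1 + ‖evalPoly p x‖)⁻¹ * ‖evalPoly p y‖ := by
    intro m y
    have : evalPoly q y = (((1 + ‖evalPoly p x‖)⁻¹ : ℝ) : ℂ) • evalPoly p y := by
      simp only [q, evalPoly, map_smul]
    rw [this, norm_smul, Complex.norm_real, Real.norm_of_nonneg (by positivity)]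
  have hmem : ∀ {m} {y : MatTuple d m}, y ∈ Gdel (adjoinPoly δ q) m ↔
      y ∈ Gdel δ m ∧ ‖evalPoly p y‖ < 1 + ‖evalPoly p x‖ := by
    intro m y
    rw [mem_Gdel_iff, mem_Gdel_iff, norm_evalMat_adjoinPoly, max_lt_iff, hq,
      inv_mul_lt_iff₀ hK, mul_one]
  have hsub : ∀ m, Gdel (adjoinPoly δ q) m ⊆ Gdel δ m := fun m y hy => (hmem.1 hy).1
  refine ⟨adjoinPoly δ q, hmem.2 ⟨hx, by linarith⟩, hsub,
    isNCFn_of_uniform_approximation fun ε hε => ?_, 1 + ‖evalPoly p x‖ + 1, fun m y hy => ?_⟩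
  · obtain ⟨p', hp'⟩ := h ε hε
    exact ⟨p', fun m y hy => hp' m y (hsub m hy)⟩
  · rw [opNorm_eq_norm]
    have h1 := norm_sub_norm_le (φ m y) (evalPoly p y)
    rw [norm_sub_rev] at h1
    linarith [hp m y (hsub m hy), (hmem.1 hy).2]

end Converse

end FreeHolo

/-- **Theorem 2.1.**  A graded function on a nonempty free open set `D` is free
holomorphic iff it is locally uniformly approximable by free polynomials. -/
theorem freeHolo_iff_locally_approximable {d : ℕ} (hd : 0 < d)
    (D : ∀ n, Set (MatTuple d n)) (hD : IsFreeOpen D)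
    (hne : ∃ (k : ℕ) (z : MatTuple d k), z ∈ D k)
    (φ : ∀ n, MatTuple d n → Matrix (Fin n) (Fin n) ℂ) :
    IsFreeHolo D φ ↔
      ∀ n, ∀ x ∈ D n, ∃ (J : ℕ) (δ : Matrix (Fin J) (Fin J) (FreeAlgebra ℂ (Fin d))),
        x ∈ Gdel δ n ∧ (∀ m, Gdel δ m ⊆ D m) ∧
        ∃ p : ℕ → FreeAlgebra ℂ (Fin d),
          ∀ ε : ℝ, 0 < ε → ∃ k₀ : ℕ, ∀ k ≥ k₀, ∀ m, ∀ y ∈ Gdel δ m,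
            opNorm (evalPoly (p k) y - φ m y) ≤ ε := by
  constructor
  · intro h n x hx
    obtain ⟨J, δ, hxδ, hδ, hnc, C, hC⟩ := h n x hx
    obtain ⟨δ', hxδ', hδ', hp⟩ := FreeHolo.exists_uniform_approximation hnc hC hxδ
    exact ⟨J, δ', hxδ', fun m => (hδ' m).trans (hδ m), hp⟩
  · intro h n x hx
    obtain ⟨J, δ, hxδ, hδ, p, hp⟩ := h n x hx
    obtain ⟨δ', hxδ', hδ', hnc, hC⟩ := FreeHolo.exists_bounded_of_uniform_approximation
      (fun ε hε => (hp ε hε).imp' p fun k hk => hk k le_rfl) hxδ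
    exact ⟨J + 1, δ', hxδ', fun m => (hδ' m).trans (hδ m), hnc, hC⟩
end
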